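/- Let d ≥ 2 and 0 < α < d, and let P be a simple point process on ℝ^d satisfying Assumptions (A1) and (A2). Then for every i ∈ {1,2,3} and every ε > 0 there exists δ > 0 such that, P-a.s. for all sufficiently large L, the set ξ_L is finite with at least two points and the isoperimetric profile satisfies φ^i_L(t) ≥ δ·min{ L^{−ε}, t^{−1/d}·L^{−1} } for all 0 < t ≤ 1/2; in particular Cheeger's constant satisfies Φ^i_L ≥ δ·L^{−1}. -/

import Mathlib

open MeasureTheory Filter
open scoped ENNReal

noncomputable section

abbrev Pt (d : ℕ) := EuclideanSpace ℝ (Fin d)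
abbrev Config (d : ℕ) := Set (Pt d)

def IsLocallyFinite {d : ℕ} (ξ : Config d) : Prop :=
  ∀ A : Set (Pt d), Bornology.IsBounded A → (ξ ∩ A).Finite

instance configMS (d : ℕ) : MeasurableSpace (Config d) :=
  MeasurableSpace.generateFrom
    { E | ∃ (A : Set (Pt d)) (n : ℕ), Bornology.IsBounded A ∧ MeasurableSet A ∧
        E = {ξ : Config d | (ξ ∩ A).ncard = n} }

def IsPointProcess {d : ℕ} (P : Measure (Config d)) : Prop :=
  IsProbabilityMeasure P ∧ ∀ᵐ ξ ∂P, IsLocallyFinite ξ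

def cube (d : ℕ) (L : ℝ) : Set (Pt d) := {p | ∀ i, |p i| ≤ L / 2}

/-- The cube `B_x = Kx + [0,K)^d`. -/
def Kcube (d : ℕ) (K : ℝ) (x : Fin d → ℤ) : Set (Pt d) :=
  {p | ∀ i, K * x i ≤ p i ∧ p i < K * x i + K}

/-- Bernoulli(p) i.i.d. field on `ℤ^d`, characterized by its cylinder probabilities. -/
def IsBernoulliField (d : ℕ) (p : ℝ) (ν : Measure ((Fin d → ℤ) → Bool)) : Prop :=
  IsProbabilityMeasure ν ∧
  ∀ (S : Finset (Fin d → ℤ)) (b : (Fin d → ℤ) → Bool),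
    ν {ω | ∀ x ∈ S, ω x = b x} = ∏ x ∈ S, ENNReal.ofReal (if b x then p else 1 - p)

/-- Assumption (A1): for every p < 1 there is K such that the good-box field
dominates an i.i.d. Bernoulli(p) field, in the sense of a monotone coupling. -/
def AssumptionA1 {d : ℕ} (P : Measure (Config d)) : Prop :=
  ∀ p : ℝ, 0 < p → p < 1 → ∃ K : ℝ, 0 < K ∧
    ∃ (μ : Measure (Config d × ((Fin d → ℤ) → Bool))) (ν : Measure ((Fin d → ℤ) → Bool)),
      IsProbabilityMeasure μ ∧ IsBernoulliField d p ν ∧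
      μ.map Prod.fst = P ∧ μ.map Prod.snd = ν ∧
      ∀ᵐ ω ∂μ, ∀ x : Fin d → ℤ, ω.2 x = true → (ω.1 ∩ Kcube d K x).Nonempty

/-- `R_A(ξ) = Σ_{x ∈ ξ∩A} Σ_{y ∈ ξ} exp(-|x-y|^α)` (valued in `ℝ≥0∞`). -/
def Rfun {d : ℕ} (α : ℝ) (A : Set (Pt d)) (ξ : Config d) : ℝ≥0∞ :=
  ∑' (x : ↥(ξ ∩ A)) (y : ↥ξ), ENNReal.ofReal (Real.exp (-(dist (x : Pt d) (y : Pt d)) ^ α))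

/-- The cube `V_x = L^ε x + [0, L^ε)^d`. -/
def Vcube (d : ℕ) (L : ℕ) (ε : ℝ) (x : Fin d → ℤ) : Set (Pt d) :=
  {p | ∀ i, (L : ℝ) ^ ε * x i ≤ p i ∧ p i < (L : ℝ) ^ ε * x i + (L : ℝ) ^ ε}

/-- Assumption (A2). -/
def AssumptionA2 {d : ℕ} (α : ℝ) (P : Measure (Config d)) : Prop :=
  ∀ ε : ℝ, 0 < ε → ε < 1 → ∃ C : ℝ, 0 < C ∧
    ∀ᵐ ξ ∂P, ∀ᶠ L : ℕ in atTop,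
      ∀ x : Fin d → ℤ, (Vcube d L ε x ∩ cube d L).Nonempty →
        Rfun α (Vcube d L ε x) ξ ≤ ENNReal.ofReal (C * (L : ℝ) ^ (ε * d))

noncomputable instance {d : ℕ} : DecidableEq (Pt d) := Classical.decEq _

variable {d : ℕ}

/-- jump rate `e^{-|x-y|^α}`. -/
def rate (α : ℝ) (x y : Pt d) : ℝ := Real.exp (-(dist x y) ^ α)

/-- weights `w^i_x` for the three models `i = 1,2,3`. -/
def wgt (α : ℝ) (E : Finset (Pt d)) (i : ℕ) (x : Pt d) : ℝ :=
  if i = 1 then 1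
  else if i = 2 then ∑ z ∈ E.erase x, rate α x z
  else max 1 (∑ z ∈ E.erase x, rate α x z)

/-- `W^i(U) = Σ_{x∈U} w^i_x`. -/
def Wsum (α : ℝ) (E : Finset (Pt d)) (i : ℕ) (U : Finset (Pt d)) : ℝ :=
  ∑ x ∈ U, wgt α E i x

/-- the reversible probability measure `ν^i(x) = w^i_x / W^i(ξ_L)`. -/
def nu (α : ℝ) (E : Finset (Pt d)) (i : ℕ) (x : Pt d) : ℝ :=
  wgt α E i x / Wsum α E i E

/-- conductance `I^i_U`. -/
def conduct (α : ℝ) (E : Finset (Pt d)) (i : ℕ) (U : Finset (Pt d)) : ℝ :=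
  (∑ x ∈ U, ∑ y ∈ E \ U, rate α x y) / Wsum α E i U

/-- isoperimetric profile `φ^i_L(t)` (valued in `ℝ≥0∞`; `∞` if no admissible `U`). -/
def isoProfile (α : ℝ) (E : Finset (Pt d)) (i : ℕ) (t : ℝ) : ℝ≥0∞ :=
  ⨅ (U : Finset (Pt d)) (_ : U ⊆ E) (_ : U.Nonempty)
    (_ : Wsum α E i U ≤ t * Wsum α E i E), ENNReal.ofReal (conduct α E i U)

/-- Cheeger's constant `Φ^i_L = φ^i_L(1/2)`. -/
def cheeger (α : ℝ) (E : Finset (Pt d)) (i : ℕ) : ℝ≥0∞ := isoProfile α E i (1 / 2)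

/-- Dirichlet form `E_i(f)`. -/
def dirichlet (α : ℝ) (E : Finset (Pt d)) (i : ℕ) (f : Pt d → ℝ) : ℝ :=
  (1 / 2) * ∑ x ∈ E, ∑ y ∈ E.erase x,
    nu α E i x * (rate α x y / wgt α E i x) * (f x - f y) ^ 2

/-- variance `Var_i(f) = ν^i(f²) - ν^i(f)²`. -/
def varNu (α : ℝ) (E : Finset (Pt d)) (i : ℕ) (f : Pt d → ℝ) : ℝ :=
  (∑ x ∈ E, nu α E i x * f x ^ 2) - (∑ x ∈ E, nu α E i x * f x) ^ 2

/-- nonconstant on `E`. -/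
def Nonconst (E : Finset (Pt d)) (f : Pt d → ℝ) : Prop := ∃ x ∈ E, ∃ y ∈ E, f x ≠ f y

/-- Poincaré constant `γ^i(L) = sup { Var_i f / E_i f : f nonconstant }`. -/
def gammaP (α : ℝ) (E : Finset (Pt d)) (i : ℕ) : ℝ≥0∞ :=
  ⨆ (f : Pt d → ℝ) (_ : Nonconst E f),
    ENNReal.ofReal (varNu α E i f / dirichlet α E i f)

/-- the generator `L^i` as a matrix on `E`. -/
def gen (α : ℝ) (E : Finset (Pt d)) (i : ℕ) : Matrix ↥E ↥E ℝ :=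
  Matrix.of fun x y =>
    if x = y then -(∑ z ∈ E.erase (x : Pt d), rate α (x : Pt d) z / wgt α E i (x : Pt d))
    else rate α (x : Pt d) (y : Pt d) / wgt α E i (x : Pt d)

/-- heat kernel `H^i_t = exp(t L^i)`, via the exponential series. -/
def heatKernel (α : ℝ) (E : Finset (Pt d)) (i : ℕ) (t : ℝ) (x y : ↥E) : ℝ :=
  ∑' n : ℕ, t ^ n / (n.factorial : ℝ) * (gen α E i ^ n) x y

/-- uniform mixing time `τ^i(L)` (valued in `ℝ≥0∞`). -/
def mixTime (α : ℝ) (E : Finset (Pt d)) (i : ℕ) : ℝ≥0∞ :=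
  ⨅ (t : ℝ) (_ : 0 < t)
    (_ : ∀ x y : ↥E,
      |heatKernel α E i t x y - nu α E i (y : Pt d)| / nu α E i (y : Pt d) ≤ Real.exp (-1)),
    ENNReal.ofReal t

/-- `c₀⁺(U)`: nonnegative, nonconstant, vanishing outside `U`. -/
def c0plus (E U : Finset (Pt d)) (f : Pt d → ℝ) : Prop :=
  (∀ x ∈ E, 0 ≤ f x) ∧ Nonconst E f ∧ ∀ x ∈ E, x ∉ U → f x = 0

/-- `λ^i(U) = inf { E_i f / Var_i f : f ∈ c₀⁺(U) }`. -/
def lambdaU (α : ℝ) (E : Finset (Pt d)) (i : ℕ) (U : Finset (Pt d)) : ℝ :=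
  sInf {r : ℝ | ∃ f : Pt d → ℝ, c0plus E U f ∧ r = dirichlet α E i f / varNu α E i f}

/-- `ν^i_* = min_{x∈E} ν^i(x)`. -/
def nuStar (α : ℝ) (E : Finset (Pt d)) (i : ℕ) : ℝ :=
  sInf (nu α E i '' ↑E)

/-- `ν^i(U)` for a subset `U`. -/
def nuSet (α : ℝ) (E : Finset (Pt d)) (i : ℕ) (U : Finset (Pt d)) : ℝ :=
  ∑ x ∈ U, nu α E i x

/-- spectral profile `Λ^i(r)`. -/
def specProfile (α : ℝ) (E : Finset (Pt d)) (i : ℕ) (r : ℝ) : ℝ :=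
  sInf {l : ℝ | ∃ U : Finset (Pt d), U ⊆ E ∧
    nuStar α E i ≤ nuSet α E i U ∧ nuSet α E i U ≤ r ∧ l = lambdaU α E i U}

/-- hybrid conductance profile `ψ_L(t)`: model-3 conductance, counting constraint. -/
def hybridProfile (α : ℝ) (E : Finset (Pt d)) (t : ℝ) : ℝ≥0∞ :=
  ⨅ (U : Finset (Pt d)) (_ : U ⊆ E) (_ : U.Nonempty)
    (_ : (U.card : ℝ) ≤ t * (E.card : ℝ)), ENNReal.ofReal (conduct α E 3 U)

/-- The discrete box `{0, …, N - 1}^d`. -/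
def gridBox (d N : ℕ) : Finset (Fin d → ℕ) := Fintype.piFinset fun _ => Finset.range N

theorem mem_gridBox {d N : ℕ} {x : Fin d → ℕ} : x ∈ gridBox d N ↔ ∀ i, x i < N := by
  simp [gridBox]

theorem card_gridBox (d N : ℕ) : (gridBox d N).card = N ^ d := by
  simp [gridBox]

/-- Lower end points of the edges of the box along which the colouring `A` changes. -/
def bdrySites {d : ℕ} (N : ℕ) (A : (Fin d → ℕ) → ZMod 2) : Finset (Fin d → ℕ) :=
  (gridBox d N).filter fun x => ∃ i, x i + 1 < N ∧ A (x + Pi.single i 1) ≠ A x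

theorem mem_bdrySites {d N : ℕ} {A : (Fin d → ℕ) → ZMod 2} {x : Fin d → ℕ} :
    x ∈ bdrySites N A ↔
      (∀ j, x j < N) ∧ ∃ i, x i + 1 < N ∧ A (x + Pi.single i 1) ≠ A x := by
  simp [bdrySites, mem_gridBox]

theorem update_add_single {d : ℕ} (x : Fin d → ℕ) (i : Fin d) (t : ℕ) :
    Function.update x i t + Pi.single i 1 = Function.update x i (t + 1) := by
  ext j
  by_cases h : j = i
  · subst h; simp
  · simp [h]

/-- On a line of the box that avoids `bdrySites`, the colouring is constant. -/
theorem eq_on_line {d N : ℕ} {A : (Fin d → ℕ) → ZMod 2} {x : Fin d → ℕ} {i : Fin d}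
    (hx : ∀ j, x j < N) (h : ∀ t, t < N → Function.update x i t ∉ bdrySites N A) :
    ∀ t, t < N → A (Function.update x i t) = A (Function.update x i 0) := by
  intro t
  induction t with
  | zero => intro _; rfl
  | succ t ih =>
    intro ht
    rw [← ih (by omega)]
    by_contra hne
    refine h t (by omega) (mem_bdrySites.2 ⟨fun j => ?_, i, by simpa using ht, ?_⟩)
    · by_cases hj : j = i
      · subst hj; simp; omega
      · simp [hj, hx j]
    · rwa [update_add_single]

theorem lintegral_pi_count {d : ℕ} (f : (Fin d → ℕ) → ℝ≥0∞) :
    ∫⁻ x, f x ∂(Measure.pi fun _ : Fin d => (Measure.count : Measure ℕ)) = ∑' x, f x := by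
  rw [lintegral_countable']
  refine tsum_congr fun x => ?_
  rw [Measure.pi_singleton]
  simp

/-- Discrete isoperimetric inequality in a box, with a correction for lines contained in the set. -/
theorem card_rpow_le_bdry {d : ℕ} (hd : 2 ≤ d) {N : ℕ} (A : (Fin d → ℕ) → ZMod 2)
    (a : ZMod 2) :
    (((gridBox d N).filter fun x => A x = a).card : ℝ) ^ (((d : ℝ) - 1) / d) ≤
      (bdrySites N A).card + (((gridBox d N).filter fun x => A x = a).card : ℝ) / N := by
  classical
  set S := (gridBox d N).filter fun x => A x = a with hS
  set D := bdrySites N A with hD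
  rcases Nat.eq_zero_or_pos N with hN | hN
  · have : S = ∅ := by
      rw [hS, Finset.filter_eq_empty_iff]
      intro x hx
      have := mem_gridBox.1 hx ⟨0, by omega⟩
      omega
    have hd' : (2 : ℝ) ≤ d := by exact_mod_cast hd
    rw [this]
    simp only [Finset.card_empty, Nat.cast_zero, zero_div, add_zero]
    rw [Real.zero_rpow]
    · positivity
    · apply ne_of_gt; apply div_pos <;> linarith
  have hd' : (2 : ℝ) ≤ d := by exact_mod_cast hd
  have hN' : (0 : ℝ) < N := by exact_mod_cast hN
  let f : (Fin d → ℕ) → ℝ≥0∞ := fun x =>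
    (if x ∈ D then 1 else 0) + (if x ∈ S then (N : ℝ≥0∞)⁻¹ else 0)
  have hline : ∀ x ∈ S, ∀ i, 1 ≤ ∑' t, f (Function.update x i t) := by
    intro x hx i
    obtain ⟨hxB, hxA⟩ := Finset.mem_filter.1 hx
    rw [mem_gridBox] at hxB
    by_cases h : ∃ t, t < N ∧ Function.update x i t ∈ D
    · obtain ⟨t, -, ht⟩ := h
      calc (1 : ℝ≥0∞) ≤ f (Function.update x i t) := by simp [f, ht]
        _ ≤ _ := ENNReal.le_tsum t
    · push Not at h
      have hc := eq_on_line hxB h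
      have hxi := hc (x i) (hxB i)
      rw [Function.update_eq_self, hxA] at hxi
      have hmem : ∀ t, t < N → Function.update x i t ∈ S := by
        intro t ht
        refine Finset.mem_filter.2 ⟨mem_gridBox.2 fun j => ?_, by rw [hc t ht, ← hxi]⟩
        by_cases hj : j = i
        · subst hj; simpa using ht
        · simp [hj, hxB j]
      calc (1 : ℝ≥0∞) = ∑ t ∈ Finset.range N, (N : ℝ≥0∞)⁻¹ := by
            rw [Finset.sum_const, Finset.card_range, nsmul_eq_mul, ENNReal.mul_inv_cancel]
            · exact_mod_cast hN.ne'
            · exact ENNReal.natCast_ne_top N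
        _ ≤ ∑ t ∈ Finset.range N, f (Function.update x i t) := by
            refine Finset.sum_le_sum fun t ht => ?_
            simp [f, hmem t (Finset.mem_range.1 ht)]
        _ ≤ _ := ENNReal.sum_le_tsum _
  have hconj : Real.HolderConjugate (Fintype.card (Fin d)) ((d : ℝ) / (d - 1)) := by
    rw [Fintype.card_fin]
    exact (Real.holderConjugate_iff_eq_conjExponent (by linarith)).2 rfl
  have key := lintegral_prod_lintegral_pow_le (A := fun _ : Fin d => ℕ)
    (μ := fun _ => (Measure.count : Measure ℕ)) hconj (f := f) (measurable_of_countable f)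
  simp only [lintegral_pi_count, Fintype.card_fin] at key
  have hlow : (S.card : ℝ≥0∞) ≤ (∑' x, f x) ^ ((d : ℝ) / (d - 1)) := by
    refine le_trans ?_ key
    calc (S.card : ℝ≥0∞) = ∑ x ∈ S, (1 : ℝ≥0∞) := by simp
      _ ≤ ∑ x ∈ S, ∏ i, (∫⁻ t, f (Function.update x i t) ∂Measure.count) ^
            ((1 : ℝ) / ((d : ℝ) - 1)) := by
          refine Finset.sum_le_sum fun x hx => ?_
          rw [← Finset.prod_const_one (s := (Finset.univ : Finset (Fin d)))]
          refine Finset.prod_le_prod' fun i _ => ?_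
          rw [lintegral_count]
          exact ENNReal.one_le_rpow (hline x hx i) (by apply div_pos <;> linarith)
      _ ≤ _ := ENNReal.sum_le_tsum _
  have hsum : ∑' x, f x = (D.card : ℝ≥0∞) + S.card * (N : ℝ≥0∞)⁻¹ := by
    rw [ENNReal.tsum_add]
    congr 1
    · rw [tsum_eq_sum (s := D) (fun x hx => if_neg hx)]
      simp
    · rw [tsum_eq_sum (s := S) (fun x hx => if_neg hx)]
      rw [Finset.sum_congr rfl (g := fun _ => (N : ℝ≥0∞)⁻¹) (fun x hx => by simp [hx])]
      simp
  have hreal : (D.card : ℝ≥0∞) + S.card * (N : ℝ≥0∞)⁻¹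
      = ENNReal.ofReal (D.card + S.card / N) := by
    rw [ENNReal.ofReal_add (by positivity) (by positivity), ENNReal.ofReal_natCast,
      ENNReal.ofReal_div_of_pos hN', ENNReal.ofReal_natCast, ENNReal.ofReal_natCast,
      div_eq_mul_inv]
  rw [hsum, hreal, ENNReal.ofReal_rpow_of_nonneg (by positivity)
    (by apply div_nonneg <;> linarith), ← ENNReal.ofReal_natCast,
    ENNReal.ofReal_le_ofReal_iff (by positivity)] at hlow
  have hexp : (0 : ℝ) ≤ ((d : ℝ) - 1) / d := by apply div_nonneg <;> linarith
  calc (S.card : ℝ) ^ (((d : ℝ) - 1) / d)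
      ≤ (((D.card : ℝ) + S.card / N) ^ ((d : ℝ) / (d - 1))) ^ (((d : ℝ) - 1) / d) :=
        Real.rpow_le_rpow (by positivity) hlow hexp
    _ = _ := by
        rw [← Real.rpow_mul (by positivity)]
        have : (d : ℝ) / (d - 1) * (((d : ℝ) - 1) / d) = 1 := by
          have h1 : (d : ℝ) ≠ 0 := by linarith
          have h2 : (d : ℝ) - 1 ≠ 0 := by linarith
          field_simp
        rw [this, Real.rpow_one]

/-- The constant in the isoperimetric inequality of the box. -/
def isoConst (d : ℕ) : ℝ := 1 - (1 / 2 : ℝ) ^ ((1 : ℝ) / d)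

theorem isoConst_pos {d : ℕ} (hd : 2 ≤ d) : 0 < isoConst d := by
  have : (1 / 2 : ℝ) ^ ((1 : ℝ) / d) < 1 :=
    Real.rpow_lt_one (by norm_num) (by norm_num) (by positivity)
  unfold isoConst
  linarith

/-- Isoperimetric inequality for a colour class occupying at most half of the box. -/
theorem isoperimetry_of_le_half {d : ℕ} (hd : 2 ≤ d) {N : ℕ} (A : (Fin d → ℕ) → ZMod 2)
    (a : ZMod 2)
    (hhalf : 2 * ((gridBox d N).filter fun x => A x = a).card ≤ N ^ d) :
    isoConst d * (((gridBox d N).filter fun x => A x = a).card : ℝ) ^ (((d : ℝ) - 1) / d) ≤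
      (bdrySites N A).card := by
  have h := card_rpow_le_bdry hd (N := N) A a
  set n := ((gridBox d N).filter fun x => A x = a).card
  have hd' : (2 : ℝ) ≤ d := by exact_mod_cast hd
  rcases Nat.eq_zero_or_pos n with hn | hn
  · rw [hn, Nat.cast_zero, Real.zero_rpow, mul_zero]
    · positivity
    · apply ne_of_gt; apply div_pos <;> linarith
  have hn' : (0 : ℝ) < n := by exact_mod_cast hn
  have hN : 0 < N := by
    rcases Nat.eq_zero_or_pos N with h0 | h0
    · rw [h0, zero_pow (by omega)] at hhalf; omega
    · exact h0
  have hN' : (0 : ℝ) < N := by exact_mod_cast hN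
  have hhalf' : (n : ℝ) ≤ 1 / 2 * (N : ℝ) ^ (d : ℝ) := by
    rw [Real.rpow_natCast]
    have : (2 * n : ℝ) ≤ (N : ℝ) ^ d := by exact_mod_cast hhalf
    linarith
  have hroot : (n : ℝ) ^ ((1 : ℝ) / d) ≤ (1 / 2 : ℝ) ^ ((1 : ℝ) / d) * N := by
    calc (n : ℝ) ^ ((1 : ℝ) / d) ≤ (1 / 2 * (N : ℝ) ^ (d : ℝ)) ^ ((1 : ℝ) / d) :=
          Real.rpow_le_rpow hn'.le hhalf' (by positivity)
      _ = _ := by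
          rw [Real.mul_rpow (by norm_num) (by positivity), ← Real.rpow_mul hN'.le,
            mul_one_div_cancel (by linarith), Real.rpow_one]
  have hsplit : (n : ℝ) = (n : ℝ) ^ (((d : ℝ) - 1) / d) * (n : ℝ) ^ ((1 : ℝ) / d) := by
    rw [← Real.rpow_add hn', ← add_div, sub_add_cancel, div_self (by linarith), Real.rpow_one]
  have hdiv : (n : ℝ) / N ≤ (n : ℝ) ^ (((d : ℝ) - 1) / d) * (1 / 2 : ℝ) ^ ((1 : ℝ) / d) := by
    rw [div_le_iff₀ hN', mul_assoc]
    conv_lhs => rw [hsplit]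
    exact mul_le_mul_of_nonneg_left hroot (Real.rpow_nonneg hn'.le _)
  unfold isoConst
  linarith

theorem card_filter_zmod_two {d N : ℕ} (A : (Fin d → ℕ) → ZMod 2) :
    ((gridBox d N).filter fun x => A x = 0).card +
      ((gridBox d N).filter fun x => A x = 1).card = N ^ d := by
  rw [← card_gridBox, ← Finset.card_filter_add_card_filter_not (s := gridBox d N)
    (fun x => A x = 0)]
  congr 2
  refine Finset.filter_congr fun x _ => ?_
  generalize A x = y
  revert y; decide

/-- Isoperimetric inequality for the smaller of the two colour classes. -/
theorem isoperimetry_min {d : ℕ} (hd : 2 ≤ d) {N : ℕ} (A : (Fin d → ℕ) → ZMod 2) :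
    isoConst d * (min (((gridBox d N).filter fun x => A x = 0).card : ℝ)
      (((gridBox d N).filter fun x => A x = 1).card : ℝ)) ^ (((d : ℝ) - 1) / d) ≤
      (bdrySites N A).card := by
  have hc := card_filter_zmod_two (N := N) A
  rcases le_total ((gridBox d N).filter fun x => A x = 0).card
    ((gridBox d N).filter fun x => A x = 1).card with h | h
  · rw [min_eq_left (by exact_mod_cast h)]
    exact isoperimetry_of_le_half hd A 0 (by omega)
  · rw [min_eq_right (by exact_mod_cast h)]
    exact isoperimetry_of_le_half hd A 1 (by omega)

/-- Poincaré lemma in a box: a closed discrete one-form is exact. -/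
theorem exists_potential {d N : ℕ} {M : Type*} [AddCommGroup M] (ω : (Fin d → ℕ) → Fin d → M)
    (hω : ∀ x : Fin d → ℕ, (∀ j, x j < N) → ∀ i j, i ≠ j → x i + 1 < N → x j + 1 < N →
      ω x i + ω (x + Pi.single i 1) j = ω x j + ω (x + Pi.single j 1) i) :
    ∃ f : (Fin d → ℕ) → M, ∀ x : Fin d → ℕ, (∀ j, x j < N) → ∀ i, x i + 1 < N →
      f (x + Pi.single i 1) - f x = ω x i := by
  suffices H : ∀ k ≤ d, ∃ f : (Fin d → ℕ) → M, ∀ x : Fin d → ℕ, (∀ j, x j < N) →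
      ∀ i : Fin d, i.val < k → x i + 1 < N → f (x + Pi.single i 1) - f x = ω x i by
    obtain ⟨f, hf⟩ := H d le_rfl
    exact ⟨f, fun x hx i hi => hf x hx i i.isLt hi⟩
  intro k
  induction k with
  | zero => intro _; exact ⟨fun _ => 0, fun x hx i hi => absurd hi (Nat.not_lt_zero _)⟩
  | succ k ih =>
    intro hk
    obtain ⟨f, hf⟩ := ih (by omega)
    let c : Fin d := ⟨k, by omega⟩
    let ω' : (Fin d → ℕ) → Fin d → M := fun x i => ω x i - (f (x + Pi.single i 1) - f x)
    have hω' : ∀ x : Fin d → ℕ, (∀ j, x j < N) → ∀ i j, i ≠ j → x i + 1 < N → x j + 1 < N →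
        ω' x i + ω' (x + Pi.single i 1) j = ω' x j + ω' (x + Pi.single j 1) i := by
      intro x hx i j hij hi hj
      have h := hω x hx i j hij hi hj
      simp only [ω']
      rw [add_right_comm x (Pi.single j 1) (Pi.single i 1)]
      have h' : ω x i = ω x j + ω (x + Pi.single j 1) i - ω (x + Pi.single i 1) j :=
        eq_sub_of_add_eq h
      rw [h']
      abel
    have hzero : ∀ x : Fin d → ℕ, (∀ j, x j < N) → ∀ i : Fin d, i.val < k → x i + 1 < N →
        ω' x i = 0 := fun x hx i hi hiN => by simp only [ω', hf x hx i hi hiN, sub_self]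
    let g : (Fin d → ℕ) → M := fun x => ∑ t ∈ Finset.range (x c), ω' (Function.update x c t) c
    refine ⟨fun x => f x + g x, fun x hx i hi hiN => ?_⟩
    rcases Nat.lt_succ_iff_lt_or_eq.1 hi with hik | hik
    · have hic : i ≠ c := fun h => by rw [h] at hik; exact lt_irrefl _ hik
      have hg : g (x + Pi.single i 1) = g x := by
        have hc : (x + Pi.single i 1 : Fin d → ℕ) c = x c := by simp [hic.symm]
        simp only [g, hc]
        refine Finset.sum_congr rfl fun t ht => ?_
        have ht := Finset.mem_range.1 ht
        have hup : Function.update (x + Pi.single i 1) c t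
            = Function.update x c t + Pi.single i 1 := by
          ext j
          by_cases hj : j = c
          · subst hj; simp [hic.symm]
          · simp [hj]
        have hxc := hx c
        have hy : ∀ t, t < N → ∀ j, Function.update x c t j < N := by
          intro t ht j
          by_cases hj : j = c
          · subst hj; simpa using ht
          · simp [hj, hx j]
        have h := hω' (Function.update x c t) (hy t (by omega)) i c hic (by simpa [hic] using hiN)
          (by simp; omega)
        rw [hzero _ (hy t (by omega)) i hik (by simpa [hic] using hiN), update_add_single,
          hzero _ (hy (t + 1) (by omega)) i hik (by simpa [hic] using hiN), zero_add, add_zero] at h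
        rw [hup, h]
      simp only [hg, add_sub_add_right_eq_sub, hf x hx i hik hiN]
    · rw [show i = c from Fin.ext hik]
      have hg : g (x + Pi.single c 1) = g x + ω' x c := by
        have hc : (x + Pi.single c 1 : Fin d → ℕ) c = x c + 1 := by simp
        have hup : ∀ t, Function.update (x + Pi.single c 1) c t = Function.update x c t := by
          intro t
          ext j
          by_cases hj : j = c
          · rw [hj]; simp
          · simp [hj]
        change ∑ t ∈ Finset.range ((x + Pi.single c 1 : Fin d → ℕ) c), _ = _
        rw [hc, Finset.sum_range_succ]
        simp only [hup, Function.update_eq_self]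
        rfl
      simp only [hg, ω']
      abel

/-- Two sites at supremum distance at most one. -/
def Near {d : ℕ} (x y : Fin d → ℕ) : Prop := ∀ i, x i ≤ y i + 1 ∧ y i ≤ x i + 1

theorem Near.symm {d : ℕ} {x y : Fin d → ℕ} (h : Near x y) : Near y x :=
  fun i => ⟨(h i).2, (h i).1⟩

/-- Reachability by unit supremum-norm steps inside `X`. -/
def NearReach {d : ℕ} (X : Finset (Fin d → ℕ)) : (Fin d → ℕ) → (Fin d → ℕ) → Prop :=
  Relation.ReflTransGen fun a b => b ∈ X ∧ Near a b

def NearConn {d : ℕ} (X : Finset (Fin d → ℕ)) : Prop := ∀ x ∈ X, ∀ y ∈ X, NearReach X x y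

open Classical in
/-- The connected component of `x` in `X`. -/
def nearComp {d : ℕ} (X : Finset (Fin d → ℕ)) (x : Fin d → ℕ) : Finset (Fin d → ℕ) :=
  X.filter fun y => NearReach X x y

theorem mem_nearComp {d : ℕ} {X : Finset (Fin d → ℕ)} {x y : Fin d → ℕ} :
    y ∈ nearComp X x ↔ y ∈ X ∧ NearReach X x y := by
  simp [nearComp]

theorem mem_nearComp_self {d : ℕ} {X : Finset (Fin d → ℕ)} {x : Fin d → ℕ} (hx : x ∈ X) :
    x ∈ nearComp X x :=
  mem_nearComp.2 ⟨hx, Relation.ReflTransGen.refl⟩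

theorem NearReach.symm {d : ℕ} {X : Finset (Fin d → ℕ)} {x y : Fin d → ℕ} (hx : x ∈ X)
    (h : NearReach X x y) : NearReach X y x := by
  have : y ∈ X ∧ NearReach X y x := by
    induction h with
    | refl => exact ⟨hx, Relation.ReflTransGen.refl⟩
    | tail _ hbc ih => exact ⟨hbc.1, Relation.ReflTransGen.head ⟨ih.1, hbc.2.symm⟩ ih.2⟩
  exact this.2

theorem nearComp_eq_of_mem {d : ℕ} {X : Finset (Fin d → ℕ)} {x y : Fin d → ℕ} (hx : x ∈ X)
    (hy : y ∈ nearComp X x) : nearComp X y = nearComp X x := by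
  obtain ⟨hyX, hxy⟩ := mem_nearComp.1 hy
  ext z
  rw [mem_nearComp, mem_nearComp]
  exact ⟨fun h => ⟨h.1, hxy.trans h.2⟩, fun h => ⟨h.1, (hxy.symm hx).trans h.2⟩⟩

theorem nearComp_eq_of_near {d : ℕ} {X : Finset (Fin d → ℕ)} {x y : Fin d → ℕ} (hx : x ∈ X)
    (hy : y ∈ X) (h : Near x y) : nearComp X y = nearComp X x :=
  nearComp_eq_of_mem hx (mem_nearComp.2 ⟨hy, Relation.ReflTransGen.single ⟨hy, h⟩⟩)

theorem nearConn_nearComp {d : ℕ} {X : Finset (Fin d → ℕ)} {x : Fin d → ℕ} (hx : x ∈ X) :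
    NearConn (nearComp X x) := by
  intro a ha b hb
  rw [← nearComp_eq_of_mem hx ha] at hb ⊢
  have haX := (mem_nearComp.1 ha).1
  have hab := (mem_nearComp.1 hb).2
  clear hb
  induction hab with
  | refl => exact Relation.ReflTransGen.refl
  | tail hac hcb ih =>
    exact Relation.ReflTransGen.tail ih
      ⟨mem_nearComp.2 ⟨hcb.1, Relation.ReflTransGen.tail hac hcb⟩, hcb.2⟩

theorem single_near {d : ℕ} (x : Fin d → ℕ) (i : Fin d) : Near x (x + Pi.single i 1) := by
  intro j
  by_cases h : j = i
  · subst h; simp; omega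
  · simp [h]

theorem single_near_single {d : ℕ} (x : Fin d → ℕ) (i j : Fin d) :
    Near (x + Pi.single i 1) (x + Pi.single j 1) := by
  intro l
  by_cases h : l = i <;> by_cases h' : l = j <;> simp [h, h', Pi.single_apply] <;> grind

/-- Each connected component of the boundary of a colouring is itself a boundary. -/
theorem exists_potential_nearComp {d N : ℕ} (A : (Fin d → ℕ) → ZMod 2) {x₀ : Fin d → ℕ}
    (hx₀ : x₀ ∈ bdrySites N A) :
    ∃ f : (Fin d → ℕ) → ZMod 2, ∀ x : Fin d → ℕ, (∀ j, x j < N) → ∀ i, x i + 1 < N →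
      f (x + Pi.single i 1) - f x =
        if x ∈ nearComp (bdrySites N A) x₀ then A (x + Pi.single i 1) - A x else 0 := by
  set X := bdrySites N A with hX
  refine exists_potential (fun x i =>
    if x ∈ nearComp X x₀ then A (x + Pi.single i 1) - A x else 0) ?_
  intro x hx i j hij hi hj
  have hzero : ∀ y : Fin d → ℕ, (∀ l, y l < N) → y ∉ X → ∀ l, y l + 1 < N →
      A (y + Pi.single l 1) - A y = 0 := by
    intro y hy hyX l hl
    by_contra hne
    exact hyX (mem_bdrySites.2 ⟨hy, l, hl, fun h => hne (by rw [h, sub_self])⟩)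
  have hbox : ∀ i, x i + 1 < N → ∀ l, (x + Pi.single i 1 : Fin d → ℕ) l < N := by
    intro i hi l
    by_cases h : l = i
    · subst h; simpa using hi
    · simpa [h] using hx l
  have hji : (x + Pi.single i 1 : Fin d → ℕ) j + 1 < N := by simpa [hij.symm] using hj
  have hij' : (x + Pi.single j 1 : Fin d → ℕ) i + 1 < N := by simpa [hij] using hi
  have hsum : A (x + Pi.single i 1) - A x
      + (A (x + Pi.single i 1 + Pi.single j 1) - A (x + Pi.single i 1))
      = A (x + Pi.single j 1) - A x
      + (A (x + Pi.single j 1 + Pi.single i 1) - A (x + Pi.single j 1)) := by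
    rw [add_right_comm x (Pi.single i 1) (Pi.single j 1)]
    abel
  have mem_iff : ∀ y z, y ∈ X → z ∈ X → Near y z →
      (y ∈ nearComp X x₀ ↔ z ∈ nearComp X x₀) := by
    intro y z hy hz hyz
    have h := nearComp_eq_of_near hy hz hyz
    constructor
    · intro hm
      rw [← nearComp_eq_of_mem hx₀ hm, ← h]
      exact mem_nearComp_self hz
    · intro hm
      rw [← nearComp_eq_of_mem hx₀ hm, h]
      exact mem_nearComp_self hy
  -- Every base site of the plaquette lying in `X` has the same membership in the component.
  by_cases hall : ∃ y ∈ ({x, x + Pi.single i 1, x + Pi.single j 1} : Set (Fin d → ℕ)),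
      y ∈ nearComp X x₀
  · obtain ⟨y, hy, hyC⟩ := hall
    have hyX := (mem_nearComp.1 hyC).1
    have hin : ∀ z ∈ ({x, x + Pi.single i 1, x + Pi.single j 1} : Set (Fin d → ℕ)), z ∈ X →
        z ∈ nearComp X x₀ := by
      intro z hz hzX
      refine (mem_iff y z hyX hzX ?_).1 hyC
      have hrefl : ∀ a : Fin d → ℕ, Near a a := fun a l => ⟨by omega, by omega⟩
      rcases hy with rfl | rfl | rfl <;> rcases hz with rfl | rfl | rfl <;>
        first
        | exact hrefl _
        | exact single_near _ _
        | exact (single_near _ _).symm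
        | exact single_near_single _ _ _
    have hval : ∀ z ∈ ({x, x + Pi.single i 1, x + Pi.single j 1} : Set (Fin d → ℕ)),
        (∀ l, z l < N) → ∀ l, z l + 1 < N →
        (if z ∈ nearComp X x₀ then A (z + Pi.single l 1) - A z else 0)
          = A (z + Pi.single l 1) - A z := by
      intro z hz hzN l hl
      by_cases hzX : z ∈ X
      · rw [if_pos (hin z hz hzX)]
      · rw [hzero z hzN hzX l hl, ite_self]
    rw [hval x (by simp) hx i hi, hval x (by simp) hx j hj,
      hval (x + Pi.single i 1) (by simp) (hbox i hi) j hji,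
      hval (x + Pi.single j 1) (by simp) (hbox j hj) i hij']
    exact hsum
  · push Not at hall
    rw [if_neg (hall x (by simp)), if_neg (hall x (by simp)), if_neg (hall _ (by simp)),
      if_neg (hall _ (by simp))]

/-- A function on a box that does not change along edges is constant. -/
theorem eq_of_forall_step {d : ℕ} {M : Type*} {f : (Fin d → ℕ) → M} {a : Fin d → ℕ} {s : ℕ}
    (h : ∀ x : Fin d → ℕ, (∀ j, a j ≤ x j ∧ x j < a j + s) → ∀ i, x i + 1 < a i + s →
      f (x + Pi.single i 1) = f x) :
    ∀ x : Fin d → ℕ, (∀ j, a j ≤ x j ∧ x j < a j + s) → f x = f a := by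
  suffices H : ∀ n, ∀ x : Fin d → ℕ, ∑ j, x j = n → (∀ j, a j ≤ x j ∧ x j < a j + s) →
      f x = f a from fun x hx => H _ x rfl hx
  intro n
  induction n with
  | zero =>
    intro x hx hxa
    congr 1
    ext j
    have := (Finset.sum_eq_zero_iff.1 hx) j (Finset.mem_univ j)
    have := hxa j
    omega
  | succ n ih =>
    intro x hx hxa
    by_cases hxeq : x = a
    · rw [hxeq]
    obtain ⟨i, hi⟩ := Function.ne_iff.1 hxeq
    have hlt : a i < x i := lt_of_le_of_ne (hxa i).1 (Ne.symm hi)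
    have hxy : Function.update x i (x i - 1) + Pi.single i 1 = x := by
      rw [update_add_single, Nat.sub_add_cancel (by omega), Function.update_eq_self]
    have hy : ∀ j, a j ≤ Function.update x i (x i - 1) j ∧
        Function.update x i (x i - 1) j < a j + s := by
      intro j
      by_cases hj : j = i
      · subst hj
        have := hxa j
        simp only [Function.update_self]
        omega
      · simpa [hj] using hxa j
    have hsum : ∑ j, Function.update x i (x i - 1) j = n := by
      have := congrArg (fun y : Fin d → ℕ => ∑ j, y j) hxy
      simp only [Pi.add_apply, Finset.sum_add_distrib, Finset.sum_pi_single', Finset.mem_univ,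
        if_true] at this
      omega
    have h1 := h _ hy i (by simp only [Function.update_self]; have := hxa i; omega)
    rw [hxy] at h1
    rw [h1, ih _ hsum hy]

/-- The potential of a boundary component, normalized to vanish on at least half of the box. -/
theorem exists_small_potential {d N : ℕ} (hd : 2 ≤ d) (A : (Fin d → ℕ) → ZMod 2)
    {C : Finset (Fin d → ℕ)} (hC : ∃ x₀ ∈ bdrySites N A, nearComp (bdrySites N A) x₀ = C) :
    ∃ f : (Fin d → ℕ) → ZMod 2,
      (∀ x : Fin d → ℕ, (∀ j, x j < N) → ∀ i, x i + 1 < N →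
        f (x + Pi.single i 1) - f x = if x ∈ C then A (x + Pi.single i 1) - A x else 0) ∧
      isoConst d * (((gridBox d N).filter fun x => f x = 1).card : ℝ) ^ (((d : ℝ) - 1) / d)
        ≤ C.card := by
  obtain ⟨x₀, hx₀, rfl⟩ := hC
  obtain ⟨f, hf⟩ := exists_potential_nearComp A hx₀
  have hsub : ∀ g : (Fin d → ℕ) → ZMod 2,
      (∀ x : Fin d → ℕ, (∀ j, x j < N) → ∀ i, x i + 1 < N →
        g (x + Pi.single i 1) - g x =
          if x ∈ nearComp (bdrySites N A) x₀ then A (x + Pi.single i 1) - A x else 0) →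
      2 * ((gridBox d N).filter fun x => g x = 1).card ≤ N ^ d →
      isoConst d * (((gridBox d N).filter fun x => g x = 1).card : ℝ) ^ (((d : ℝ) - 1) / d)
        ≤ (nearComp (bdrySites N A) x₀).card := by
    intro g hg hhalf
    refine (isoperimetry_of_le_half hd g 1 hhalf).trans ?_
    refine Nat.cast_le.2 (Finset.card_le_card fun x hx => ?_)
    obtain ⟨hxN, i, hi, hne⟩ := mem_bdrySites.1 hx
    by_contra hxC
    have := hg x hxN i hi
    rw [if_neg hxC] at this
    exact hne (sub_eq_zero.1 this)
  have hcard := card_filter_zmod_two (N := N) f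
  by_cases hhalf : 2 * ((gridBox d N).filter fun x => f x = 1).card ≤ N ^ d
  · exact ⟨f, hf, hsub f hf hhalf⟩
  · have hf' : ∀ x : Fin d → ℕ, (∀ j, x j < N) → ∀ i, x i + 1 < N →
        (f (x + Pi.single i 1) + 1) - (f x + 1) =
          if x ∈ nearComp (bdrySites N A) x₀ then A (x + Pi.single i 1) - A x else 0 := by
      intro x hx i hi
      rw [add_sub_add_right_eq_sub, hf x hx i hi]
    refine ⟨fun x => f x + 1, hf', hsub (fun x => f x + 1) hf' ?_⟩
    have heq : ((gridBox d N).filter fun x => f x + 1 = 1)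
        = (gridBox d N).filter fun x => f x = 0 :=
      Finset.filter_congr fun x _ => by simp
    rw [heq]
    omega

/-- Boundary components with fewer than `k` sites can be erased from a colouring without changing
it on boxes of side `s` on which it is constant. -/
theorem exists_erase_small_components {d N k s : ℕ} (hd : 2 ≤ d) (A : (Fin d → ℕ) → ZMod 2)
    (hks : (k : ℝ) ≤ isoConst d * (s : ℝ) ^ (d - 1)) :
    ∃ A' : (Fin d → ℕ) → ZMod 2,
      bdrySites N A' ⊆
        (bdrySites N A).filter (fun x => k ≤ (nearComp (bdrySites N A) x).card) ∧
      ∀ a : Fin d → ℕ, (∀ i, a i + s ≤ N) →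
        (∀ x : Fin d → ℕ, (∀ j, a j ≤ x j ∧ x j < a j + s) → A x = A a) →
        ∀ x : Fin d → ℕ, (∀ j, a j ≤ x j ∧ x j < a j + s) → A' x = A x := by
  classical
  set X := bdrySites N A with hX
  let comps : Finset (Finset (Fin d → ℕ)) := (X.image (nearComp X)).filter fun C => C.card < k
  have hcomps : ∀ C ∈ comps, ∃ x₀ ∈ X, nearComp X x₀ = C := by
    intro C hC
    exact Finset.mem_image.1 (Finset.mem_filter.1 hC).1
  choose! D hD using fun C (hC : C ∈ comps) => exists_small_potential (N := N) hd A (hcomps C hC)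
  refine ⟨fun x => A x + ∑ C ∈ comps, D C x, ?_, ?_⟩
  · intro x hx
    obtain ⟨hxN, i, hi, hne⟩ := mem_bdrySites.1 hx
    have hdiff : ∑ C ∈ comps, D C (x + Pi.single i 1) - ∑ C ∈ comps, D C x =
        ∑ C ∈ comps, if x ∈ C then A (x + Pi.single i 1) - A x else 0 := by
      rw [← Finset.sum_sub_distrib]
      exact Finset.sum_congr rfl fun C hC => (hD C hC).1 x hxN i hi
    by_cases hxX : x ∈ X
    · refine Finset.mem_filter.2 ⟨hxX, ?_⟩
      by_contra hlt
      push Not at hlt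
      apply hne
      have hmem : nearComp X x ∈ comps :=
        Finset.mem_filter.2 ⟨Finset.mem_image_of_mem _ hxX, hlt⟩
      have hsum : (∑ C ∈ comps, if x ∈ C then A (x + Pi.single i 1) - A x else 0) =
          A (x + Pi.single i 1) - A x := by
        rw [Finset.sum_eq_single_of_mem _ hmem, if_pos (mem_nearComp_self hxX)]
        intro C hC hCne
        rw [if_neg]
        intro hxC
        obtain ⟨x₀, hx₀, rfl⟩ := hcomps C hC
        exact hCne (nearComp_eq_of_mem hx₀ hxC).symm
      rw [hsum] at hdiff
      rw [sub_eq_iff_eq_add.1 hdiff]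
      have h2 : ∀ u v w : ZMod 2, u + (u - v + w) = v + w := by decide
      exact h2 _ _ _
    · exfalso
      have hAx : A (x + Pi.single i 1) = A x := by
        by_contra h
        exact hxX (mem_bdrySites.2 ⟨hxN, i, hi, h⟩)
      apply hne
      simp only [hAx, sub_self, ite_self, Finset.sum_const_zero] at hdiff
      rw [hAx, sub_eq_zero.1 hdiff]
  · intro a ha hA x hx
    suffices H : ∀ C ∈ comps, D C x = 0 by
      simp only [Finset.sum_eq_zero H, add_zero]
    intro C hC
    have hbox : ∀ y : Fin d → ℕ, (∀ j, a j ≤ y j ∧ y j < a j + s) → ∀ j, y j < N :=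
      fun y hy j => (hy j).2.trans_le (ha j)
    have hconst := eq_of_forall_step (f := D C) (a := a) (s := s) (by
      intro y hy i hi
      have hstep : ∀ j, a j ≤ (y + Pi.single i 1 : Fin d → ℕ) j ∧
          (y + Pi.single i 1 : Fin d → ℕ) j < a j + s := by
        intro j
        have := hy j
        by_cases hj : j = i
        · subst hj; simp; omega
        · simpa [hj] using this
      have h := (hD C hC).1 y (hbox y hy) i (hi.trans_le (ha i))
      rw [hA _ hstep, hA y hy, sub_self, ite_self] at h
      exact sub_eq_zero.1 h)
    have hdich : ∀ u : ZMod 2, u = 0 ∨ u = 1 := by decide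
    refine (hdich (D C x)).resolve_right fun h1 => ?_
    have hcube : s ^ d ≤ ((gridBox d N).filter fun y => D C y = 1).card := by
      have hle := Finset.card_le_card (s := Fintype.piFinset fun j => Finset.Ico (a j) (a j + s))
        (t := (gridBox d N).filter fun y => D C y = 1) (by
          intro y hy
          have hy' : ∀ j, a j ≤ y j ∧ y j < a j + s := by simpa using hy
          refine Finset.mem_filter.2 ⟨mem_gridBox.2 (hbox y hy'), ?_⟩
          rw [hconst y hy', ← hconst x hx, h1])
      simpa using hle
    have hd' : (2 : ℝ) ≤ d := by exact_mod_cast hd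
    have hlt : C.card < k := (Finset.mem_filter.1 hC).2
    have hlt' : (C.card : ℝ) < k := by exact_mod_cast hlt
    have hpow : (s : ℝ) ^ (d - 1) = ((s ^ d : ℕ) : ℝ) ^ (((d : ℝ) - 1) / d) := by
      rw [Nat.cast_pow, ← Real.rpow_natCast, ← Real.rpow_natCast,
        ← Real.rpow_mul (Nat.cast_nonneg s), Nat.cast_sub (by omega), Nat.cast_one]
      congr 1
      field_simp
    have hmono : ((s ^ d : ℕ) : ℝ) ^ (((d : ℝ) - 1) / d) ≤
        (((gridBox d N).filter fun y => D C y = 1).card : ℝ) ^ (((d : ℝ) - 1) / d) :=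
      Real.rpow_le_rpow (Nat.cast_nonneg _) (by exact_mod_cast hcube)
        (by apply div_nonneg <;> linarith)
    have := mul_le_mul_of_nonneg_left hmono (isoConst_pos hd).le
    rw [← hpow] at this
    linarith [(hD C hC).2]

open Classical in
/-- The sites `x` of `X` such that `x` and all its upper neighbours satisfy `G`. -/
def fullyGood {d : ℕ} (G : (Fin d → ℕ) → Prop) (X : Finset (Fin d → ℕ)) :
    Finset (Fin d → ℕ) :=
  X.filter fun x => G x ∧ ∀ i, G (x + Pi.single i 1)

/-- If every connected set with at least `k` sites is at least half fully good, then each colouring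
agrees, on its monochromatic boxes, with one whose isoperimetric ratio is witnessed by fully good
boundary sites. -/
theorem exists_cleaned_coloring {d N k s : ℕ} (hd : 2 ≤ d) {G : (Fin d → ℕ) → Prop}
    (hG : ∀ X : Finset (Fin d → ℕ), X ⊆ gridBox d N → NearConn X → k ≤ X.card →
      X.card ≤ 2 * (fullyGood G X).card)
    (hks : (k : ℝ) ≤ isoConst d * (s : ℝ) ^ (d - 1)) (A : (Fin d → ℕ) → ZMod 2) :
    ∃ A' : (Fin d → ℕ) → ZMod 2,
      isoConst d * (min (((gridBox d N).filter fun x => A' x = 0).card : ℝ)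
        (((gridBox d N).filter fun x => A' x = 1).card : ℝ)) ^ (((d : ℝ) - 1) / d) ≤
        2 * (fullyGood G (bdrySites N A)).card ∧
      ∀ a : Fin d → ℕ, (∀ i, a i + s ≤ N) →
        (∀ x : Fin d → ℕ, (∀ j, a j ≤ x j ∧ x j < a j + s) → A x = A a) →
        ∀ x : Fin d → ℕ, (∀ j, a j ≤ x j ∧ x j < a j + s) → A' x = A x := by
  classical
  obtain ⟨A', hA', hbox⟩ := exists_erase_small_components (N := N) hd A hks
  refine ⟨A', (isoperimetry_min hd A').trans ?_, hbox⟩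
  set X := bdrySites N A with hX
  set Y := X.filter (fun x => k ≤ (nearComp X x).card) with hY
  have hfib : ∀ C ∈ Y.image (nearComp X), (Y.filter fun x => nearComp X x = C) = C := by
    intro C hC
    obtain ⟨x₀, hx₀, rfl⟩ := Finset.mem_image.1 hC
    obtain ⟨hx₀X, hx₀k⟩ := Finset.mem_filter.1 hx₀
    ext y
    constructor
    · intro hy
      obtain ⟨hyY, hyC⟩ := Finset.mem_filter.1 hy
      rw [← hyC]
      exact mem_nearComp_self (Finset.mem_filter.1 hyY).1
    · intro hy
      have h := nearComp_eq_of_mem hx₀X hy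
      exact Finset.mem_filter.2 ⟨Finset.mem_filter.2 ⟨(mem_nearComp.1 hy).1, by rwa [h]⟩, h⟩
  have hmain : Y.card ≤ 2 * (fullyGood G Y).card := by
    rw [Finset.card_eq_sum_card_image (nearComp X) Y,
      Finset.card_eq_sum_card_fiberwise (f := nearComp X) (s := fullyGood G Y)
        (t := Y.image (nearComp X)) (fun x hx => by
          have hx' : x ∈ Y := (Finset.mem_filter.1 (Finset.mem_coe.1 hx)).1
          exact Finset.mem_coe.2 (Finset.mem_image_of_mem _ hx')), Finset.mul_sum]
    refine Finset.sum_le_sum fun C hC => ?_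
    have hgood : ((fullyGood G Y).filter fun x => nearComp X x = C) = fullyGood G C := by
      conv_rhs => rw [← hfib C hC]
      unfold fullyGood
      rw [Finset.filter_comm]
    rw [hgood, hfib C hC]
    obtain ⟨x₀, hx₀, rfl⟩ := Finset.mem_image.1 hC
    obtain ⟨hx₀X, hx₀k⟩ := Finset.mem_filter.1 hx₀
    refine hG _ (fun y hy => ?_) (nearConn_nearComp hx₀X) hx₀k
    exact mem_gridBox.2 (mem_bdrySites.1 (mem_nearComp.1 hy).1).1
  have h1 : (bdrySites N A').card ≤ 2 * (fullyGood G X).card :=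
    (Finset.card_le_card hA').trans (hmain.trans (Nat.mul_le_mul_left 2
      (Finset.card_le_card (Finset.filter_subset_filter _ (Finset.filter_subset _ _)))))
  exact_mod_cast h1

/-- A connected set is traversed by a walk with fewer than `2 * X.card` sites. -/
theorem exists_walk {d : ℕ} {X : Finset (Fin d → ℕ)} (hne : X.Nonempty) (hX : NearConn X) :
    ∃ l : List (Fin d → ℕ), l.IsChain Near ∧ l.toFinset = X ∧ l.length + 1 = 2 * X.card := by
  suffices H : ∀ n, n + 1 ≤ X.card → ∃ l : List (Fin d → ℕ),
      l.IsChain Near ∧ l.toFinset ⊆ X ∧ l.toFinset.card = n + 1 ∧ l.length + 1 = 2 * (n + 1) by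
    have hpos := hne.card_pos
    obtain ⟨l, hl, hsub, hcard, hlen⟩ := H (X.card - 1) (by omega)
    refine ⟨l, hl, Finset.eq_of_subset_of_card_le hsub (by omega), by omega⟩
  intro n
  induction n with
  | zero =>
    intro _
    obtain ⟨x, hx⟩ := hne
    exact ⟨[x], by simp, by simpa using hx, by simp, by simp⟩
  | succ n ih =>
    intro hn
    obtain ⟨l, hl, hsub, hcard, hlen⟩ := ih (by omega)
    obtain ⟨a, ha⟩ : l.toFinset.Nonempty := Finset.card_pos.1 (by omega)
    obtain ⟨x, hx, y, hyX, hy, hxy⟩ : ∃ x ∈ l, ∃ y ∈ X, y ∉ l ∧ Near x y := by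
      by_contra! hcon
      have hall : ∀ b ∈ X, b ∈ l := by
        intro b hb
        have hreach := hX a (hsub ha) b hb
        clear hb
        induction hreach with
        | refl => simpa using ha
        | tail _ hbc ih' =>
          by_contra hc
          exact hcon _ ih' _ hbc.1 hc hbc.2
      have : X ⊆ l.toFinset := fun b hb => by simpa using hall b hb
      have := Finset.card_le_card this
      omega
    obtain ⟨l₁, l₂, rfl⟩ := List.append_of_mem hx
    refine ⟨l₁ ++ x :: y :: x :: l₂, ?_, ?_, ?_, ?_⟩
    · rw [List.isChain_split] at hl ⊢
      exact ⟨hl.1, List.isChain_cons_cons.2 ⟨hxy, List.isChain_cons_cons.2 ⟨hxy.symm, hl.2⟩⟩⟩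
    · intro z hz
      by_cases hzy : z = y
      · exact hzy ▸ hyX
      · apply hsub
        simp only [List.mem_toFinset, List.mem_append, List.mem_cons] at hz ⊢
        tauto
    · have : (l₁ ++ x :: y :: x :: l₂).toFinset = insert y (l₁ ++ x :: l₂).toFinset := by
        ext z
        simp only [List.mem_toFinset, List.mem_append, List.mem_cons, Finset.mem_insert]
        tauto
      rw [this, Finset.card_insert_of_notMem (fun h => hy (List.mem_toFinset.1 h)), hcard]
    · simp only [List.length_append, List.length_cons] at hlen ⊢
      omega

/-- The sites at supremum distance at most one from `y`. -/
def nearSites {d : ℕ} (y : Fin d → ℕ) : Finset (Fin d → ℕ) :=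
  Fintype.piFinset fun i => Finset.Icc (y i - 1) (y i + 1)

theorem card_nearSites_le {d : ℕ} (y : Fin d → ℕ) : (nearSites y).card ≤ 3 ^ d := by
  rw [nearSites, Fintype.card_piFinset]
  calc ∏ i, (Finset.Icc (y i - 1) (y i + 1)).card ≤ ∏ _i : Fin d, 3 := by
        refine Finset.prod_le_prod' fun i _ => ?_
        rw [Nat.card_Icc]
        omega
    _ = 3 ^ d := by simp

open Classical in
/-- A finite set containing all walks with `n` steps in the box. -/
def walks (d N : ℕ) : ℕ → Finset (List (Fin d → ℕ))
  | 0 => (gridBox d N).image fun x => [x]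
  | n + 1 => (walks d N n).biUnion fun l => (nearSites (l.headD 0)).image fun x => x :: l

theorem card_walks_le (d N n : ℕ) : (walks d N n).card ≤ N ^ d * (3 ^ d) ^ n := by
  induction n with
  | zero =>
    rw [pow_zero, mul_one, ← card_gridBox]
    exact Finset.card_image_le
  | succ n ih =>
    calc (walks d N (n + 1)).card ≤ (walks d N n).card * 3 ^ d :=
          Finset.card_biUnion_le_card_mul _ _ _ fun l _ =>
            Finset.card_image_le.trans (card_nearSites_le _)
      _ ≤ N ^ d * (3 ^ d) ^ n * 3 ^ d := Nat.mul_le_mul_right _ ih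
      _ = N ^ d * (3 ^ d) ^ (n + 1) := by ring

theorem mem_walks {d N : ℕ} {n : ℕ} {l : List (Fin d → ℕ)} (hl : l.IsChain Near)
    (hN : ∀ x ∈ l, x ∈ gridBox d N) (hlen : l.length = n + 1) : l ∈ walks d N n := by
  induction n generalizing l with
  | zero =>
    obtain ⟨x, rfl⟩ := List.length_eq_one_iff.1 hlen
    exact Finset.mem_image.2 ⟨x, hN x (by simp), rfl⟩
  | succ n ih =>
    match l, hlen with
    | x :: y :: l, hlen =>
      refine Finset.mem_biUnion.2 ⟨y :: l, ih hl.tail (fun z hz => hN z (by simp [hz]))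
        (by simpa using hlen), Finset.mem_image.2 ⟨x, ?_, rfl⟩⟩
      have hxy := (List.isChain_cons_cons.1 hl).1
      simp only [nearSites, Fintype.mem_piFinset, List.headD_cons, Finset.mem_Icc]
      intro i
      have := hxy i
      omega

/-- The set `X` together with its translates by the unit vectors. -/
def thicken {d : ℕ} (X : Finset (Fin d → ℕ)) : Finset (Fin d → ℕ) :=
  X.biUnion fun x => insert x (Finset.univ.image fun i => x + Pi.single i 1)

theorem card_insert_image_le {d : ℕ} (y : Fin d → ℕ) (f : Fin d → Fin d → ℕ) :
    (insert y (Finset.univ.image f)).card ≤ d + 1 :=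
  (Finset.card_insert_le _ _).trans
    (by simpa using Finset.card_image_le (s := Finset.univ) (f := f))

theorem card_thicken_le {d : ℕ} (X : Finset (Fin d → ℕ)) :
    (thicken X).card ≤ X.card * (d + 1) :=
  Finset.card_biUnion_le_card_mul _ _ _ fun x _ => card_insert_image_le x _

open Classical in
/-- Each set with few fully good sites has many bad sites in its neighbourhood. -/
theorem card_le_card_bad {d : ℕ} (G : (Fin d → ℕ) → Prop)
    (X : Finset (Fin d → ℕ)) (h : ¬ X.card ≤ 2 * (fullyGood G X).card) :
    X.card ≤ 2 * (d + 1) * ((thicken X).filter fun x => ¬ G x).card := by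
  set T := (thicken X).filter fun x => ¬ G x
  have hsub : X \ fullyGood G X ⊆
      T.biUnion fun y => insert y (Finset.univ.image fun i => y - Pi.single i 1) := by
    intro x hx
    obtain ⟨hxX, hxG⟩ := Finset.mem_sdiff.1 hx
    rw [Finset.mem_biUnion]
    by_cases hG : G x
    · obtain ⟨i, hi⟩ : ∃ i, ¬ G (x + Pi.single i 1) := by
        by_contra! hcon
        exact hxG (Finset.mem_filter.2 ⟨hxX, hG, hcon⟩)
      refine ⟨x + Pi.single i 1, Finset.mem_filter.2 ⟨?_, hi⟩, ?_⟩
      · exact Finset.mem_biUnion.2 ⟨x, hxX, Finset.mem_insert_of_mem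
          (Finset.mem_image_of_mem _ (Finset.mem_univ i))⟩
      · refine Finset.mem_insert_of_mem (Finset.mem_image.2 ⟨i, Finset.mem_univ i, ?_⟩)
        ext j
        simp
    · exact ⟨x, Finset.mem_filter.2 ⟨Finset.mem_biUnion.2 ⟨x, hxX, Finset.mem_insert_self _ _⟩, hG⟩,
        Finset.mem_insert_self _ _⟩
  have h1 := (Finset.card_le_card hsub).trans
    (Finset.card_biUnion_le_card_mul _ _ (d + 1) fun y _ => card_insert_image_le y _)
  have h2 := Finset.le_card_sdiff (fullyGood G X) X
  have : 2 * (d + 1) * T.card = 2 * (T.card * (d + 1)) := by ring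
  omega

/-- The constant governing the density of bad sites below which large connected sets are
typically at least half fully good. -/
def badRate (d : ℕ) : ℝ := Real.exp (-1) / (9 ^ d * 2 ^ (d + 1))

theorem badRate_pos (d : ℕ) : 0 < badRate d := by unfold badRate; positivity

theorem badRate_le (d : ℕ) : badRate d ≤ Real.exp (-1) := by
  unfold badRate
  refine div_le_self (Real.exp_pos _).le ?_
  exact one_le_mul_of_one_le_of_one_le (one_le_pow₀ (by norm_num)) (one_le_pow₀ (by norm_num))

theorem badRate_lt_one (d : ℕ) : badRate d < 1 :=
  (badRate_le d).trans_lt (Real.exp_lt_one_iff.2 (by norm_num))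

/-- Union bound over connected sets that are less than half fully good. -/
theorem measure_exists_not_fullyGood_le {Ω : Type*} [MeasurableSpace Ω] (μ : Measure Ω) {d : ℕ}
    (G : Ω → (Fin d → ℕ) → Prop)
    (hq : ∀ T : Finset (Fin d → ℕ), μ {ω | ∀ x ∈ T, ¬ G ω x} ≤
      ENNReal.ofReal (badRate d ^ (2 * (d + 1))) ^ T.card) {k : ℕ} (hk : 1 ≤ k) (N : ℕ) :
    μ {ω | ∃ X ⊆ gridBox d N, NearConn X ∧ k ≤ X.card ∧
        ¬ X.card ≤ 2 * (fullyGood (G ω) X).card} ≤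
      ENNReal.ofReal ((N : ℝ) ^ (2 * d) * Real.exp (-k)) := by
  classical
  set θ := badRate d with hθ
  have hθ0 := badRate_pos d
  have hsub : {ω | ∃ X ⊆ gridBox d N, NearConn X ∧ k ≤ X.card ∧
      ¬ X.card ≤ 2 * (fullyGood (G ω) X).card} ⊆
      ⋃ r ∈ Finset.Icc k (N ^ d), ⋃ l ∈ (walks d N (2 * r - 2)).filter
        (fun l => l.toFinset.card = r),
        ⋃ T ∈ (thicken l.toFinset).powerset.filter (fun T => r ≤ 2 * (d + 1) * T.card),
          {ω | ∀ x ∈ T, ¬ G ω x} := by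
    rintro ω ⟨X, hXN, hX, hkX, hbad⟩
    obtain ⟨l, hl, rfl, hlen⟩ := exists_walk (Finset.card_pos.1 (by omega)) hX
    simp only [Set.mem_iUnion]
    refine ⟨l.toFinset.card, Finset.mem_Icc.2 ⟨hkX, ?_⟩, l, ?_,
      (thicken l.toFinset).filter fun x => ¬ G ω x, ?_, fun x hx => (Finset.mem_filter.1 hx).2⟩
    · rw [← card_gridBox]
      exact Finset.card_le_card hXN
    · refine Finset.mem_filter.2
        ⟨mem_walks hl (fun x hx => hXN (by simpa using hx)) (by omega), rfl⟩
    · exact Finset.mem_filter.2 ⟨Finset.mem_powerset.2 (Finset.filter_subset _ _),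
        card_le_card_bad _ _ hbad⟩
  have hr : ∀ r ∈ Finset.Icc k (N ^ d),
      μ (⋃ l ∈ (walks d N (2 * r - 2)).filter (fun l => l.toFinset.card = r),
        ⋃ T ∈ (thicken l.toFinset).powerset.filter (fun T => r ≤ 2 * (d + 1) * T.card),
          {ω | ∀ x ∈ T, ¬ G ω x}) ≤ ENNReal.ofReal ((N : ℝ) ^ d * Real.exp (-k)) := by
    intro r hr
    have hkr := (Finset.mem_Icc.1 hr).1
    have hT : ∀ l ∈ (walks d N (2 * r - 2)).filter (fun l => l.toFinset.card = r),
        μ (⋃ T ∈ (thicken l.toFinset).powerset.filter (fun T => r ≤ 2 * (d + 1) * T.card),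
          {ω | ∀ x ∈ T, ¬ G ω x}) ≤ ENNReal.ofReal ((2 : ℝ) ^ ((d + 1) * r) * θ ^ r) := by
      intro l hl
      have hlr := (Finset.mem_filter.1 hl).2
      refine (measure_biUnion_finset_le _ _).trans ?_
      calc ∑ T ∈ (thicken l.toFinset).powerset.filter (fun T => r ≤ 2 * (d + 1) * T.card),
            μ {ω | ∀ x ∈ T, ¬ G ω x}
          ≤ ∑ T ∈ (thicken l.toFinset).powerset.filter (fun T => r ≤ 2 * (d + 1) * T.card),
            ENNReal.ofReal (θ ^ r) := by
            refine Finset.sum_le_sum fun T hT => (hq T).trans ?_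
            rw [← ENNReal.ofReal_pow (by positivity)]
            refine ENNReal.ofReal_le_ofReal ?_
            rw [← pow_mul]
            exact pow_le_pow_of_le_one hθ0.le (badRate_lt_one d).le (Finset.mem_filter.1 hT).2
        _ ≤ ENNReal.ofReal ((2 : ℝ) ^ ((d + 1) * r) * θ ^ r) := by
            rw [Finset.sum_const, nsmul_eq_mul, ENNReal.ofReal_mul (by positivity)]
            gcongr
            rw [← ENNReal.ofReal_natCast]
            refine ENNReal.ofReal_le_ofReal ?_
            have h1 := (Finset.card_filter_le (thicken l.toFinset).powerset
              (fun T => r ≤ 2 * (d + 1) * T.card))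
            rw [Finset.card_powerset] at h1
            have h2 := h1.trans (Nat.pow_le_pow_right (by norm_num : 0 < 2)
              (card_thicken_le l.toFinset))
            rw [hlr, mul_comm r] at h2
            exact_mod_cast h2
    refine (measure_biUnion_finset_le _ _).trans ((Finset.sum_le_sum hT).trans ?_)
    rw [Finset.sum_const, nsmul_eq_mul, ← ENNReal.ofReal_natCast,
      ← ENNReal.ofReal_mul (by positivity)]
    refine ENNReal.ofReal_le_ofReal ?_
    have hcard : ((((walks d N (2 * r - 2)).filter (fun l => l.toFinset.card = r)).card : ℕ) : ℝ) ≤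
        (N : ℝ) ^ d * ((9 : ℝ) ^ d) ^ r := by
      have h1 := (Finset.card_filter_le (walks d N (2 * r - 2))
        (fun l => l.toFinset.card = r)).trans (card_walks_le d N (2 * r - 2))
      have h2 : ((3 : ℕ) ^ d) ^ (2 * r - 2) ≤ (9 ^ d) ^ r := by
        calc ((3 : ℕ) ^ d) ^ (2 * r - 2) ≤ (3 ^ d) ^ (2 * r) :=
              Nat.pow_le_pow_right (by positivity) (by omega)
          _ = (9 ^ d) ^ r := by
              rw [pow_mul, ← pow_mul 3 d 2, mul_comm d 2, pow_mul 3 2 d]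
              norm_num
      have h3 := h1.trans (Nat.mul_le_mul_left _ h2)
      exact_mod_cast h3
    calc _ ≤ (N : ℝ) ^ d * ((9 : ℝ) ^ d) ^ r * ((2 : ℝ) ^ ((d + 1) * r) * θ ^ r) := by
          gcongr
      _ = (N : ℝ) ^ d * (9 ^ d * 2 ^ (d + 1) * θ) ^ r := by
          rw [pow_mul, mul_pow, mul_pow]; ring
      _ = (N : ℝ) ^ d * Real.exp (-1) ^ r := by
          rw [hθ, badRate, mul_div_cancel₀ _ (by positivity)]
      _ ≤ (N : ℝ) ^ d * Real.exp (-k) := by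
          rw [← Real.exp_nat_mul]
          gcongr
          have : (k : ℝ) ≤ r := by exact_mod_cast hkr
          linarith
  refine (measure_mono hsub).trans ((measure_biUnion_finset_le _ _).trans
    ((Finset.sum_le_sum hr).trans ?_))
  rw [Finset.sum_const, nsmul_eq_mul, ← ENNReal.ofReal_natCast,
    ← ENNReal.ofReal_mul (by positivity)]
  refine ENNReal.ofReal_le_ofReal ?_
  have hc : ((Finset.Icc k (N ^ d)).card : ℝ) ≤ (N : ℝ) ^ d := by
    rw [Nat.card_Icc]
    exact_mod_cast (by omega : N ^ d + 1 - k ≤ N ^ d)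
  calc _ ≤ (N : ℝ) ^ d * ((N : ℝ) ^ d * Real.exp (-k)) := by gcongr
    _ = _ := by ring

/-- The sites of the block `z + [0,b)^d`. -/
def blockSites {d : ℕ} (z : Fin d → ℕ) (b : ℕ) : Finset (Fin d → ℕ) :=
  Fintype.piFinset fun i => Finset.Ico (z i) (z i + b)

theorem mem_blockSites {d : ℕ} {z y : Fin d → ℕ} {b : ℕ} :
    y ∈ blockSites z b ↔ ∀ i, z i ≤ y i ∧ y i < z i + b := by
  simp [blockSites]

theorem card_blockSites {d : ℕ} (z : Fin d → ℕ) (b : ℕ) : (blockSites z b).card = b ^ d := by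
  simp [blockSites]

/-- Union bound over blocks without good sites. -/
theorem measure_exists_bad_block_le {Ω : Type*} [MeasurableSpace Ω] (μ : Measure Ω) {d : ℕ}
    (G : Ω → (Fin d → ℕ) → Prop) {q : ℝ} (hq0 : 0 ≤ q)
    (hq : ∀ T : Finset (Fin d → ℕ), μ {ω | ∀ x ∈ T, ¬ G ω x} ≤ ENNReal.ofReal q ^ T.card)
    {b : ℕ} (hb : 1 ≤ b) (N : ℕ) :
    μ {ω | ¬ ∀ z : Fin d → ℕ, (∀ i, z i + b ≤ N) → ∃ y ∈ blockSites z b, G ω y} ≤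
      ENNReal.ofReal ((N : ℝ) ^ d * q ^ b ^ d) := by
  have hsub : {ω | ¬ ∀ z : Fin d → ℕ, (∀ i, z i + b ≤ N) → ∃ y ∈ blockSites z b, G ω y} ⊆
      ⋃ z ∈ gridBox d N, {ω | ∀ x ∈ blockSites z b, ¬ G ω x} := by
    intro ω hω
    simp only [Set.mem_ofPred_eq, not_forall, not_exists, not_and] at hω
    obtain ⟨z, hz, hbad⟩ := hω
    simp only [Set.mem_iUnion]
    exact ⟨z, mem_gridBox.2 fun i => by have := hz i; omega, hbad⟩
  refine (measure_mono hsub).trans ((measure_biUnion_finset_le _ _).trans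
    ((Finset.sum_le_sum fun z _ => hq _).trans ?_))
  simp only [card_blockSites]
  rw [Finset.sum_const, nsmul_eq_mul, ← ENNReal.ofReal_pow hq0, ← ENNReal.ofReal_natCast,
    ← ENNReal.ofReal_mul (by positivity), card_gridBox]
  push_cast
  exact le_rfl

theorem isBounded_Kcube (K : ℝ) (x : Fin d → ℤ) : Bornology.IsBounded (Kcube d K x) := by
  refine ((PiLp.antilipschitzWith_ofLp 2 fun _ : Fin d => ℝ).isBounded_preimage
    (Metric.isBounded_Icc (fun i => K * (x i : ℝ)) fun i => K * (x i : ℝ) + K)).subset ?_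
  intro p hp
  exact ⟨fun i => (hp i).1, fun i => (hp i).2.le⟩

theorem isBounded_cube (L : ℝ) : Bornology.IsBounded (cube d L) := by
  refine ((PiLp.antilipschitzWith_ofLp 2 fun _ : Fin d => ℝ).isBounded_preimage
    (Metric.isBounded_Icc (fun _ => -(L / 2)) fun _ => L / 2)).subset ?_
  intro p hp
  exact ⟨fun i => (abs_le.1 (hp i)).1, fun i => (abs_le.1 (hp i)).2⟩

theorem measurableSet_Kcube (K : ℝ) (x : Fin d → ℤ) : MeasurableSet (Kcube d K x) := by
  have : Kcube d K x = ⋂ i, (fun p : Pt d => p i) ⁻¹' Set.Ico (K * (x i : ℝ)) (K * x i + K) := by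
    ext p
    simp [Kcube]
  rw [this]
  exact MeasurableSet.iInter fun i => measurableSet_Ico.preimage (by fun_prop)

/-- Under Assumption (A1), boxes of a suitable scale are empty with a probability that is
exponentially small in their number. -/
theorem exists_scale {P : Measure (Config d)} (hP : IsPointProcess P) (hA1 : AssumptionA1 P)
    {q : ℝ} (hq0 : 0 < q) (hq1 : q < 1) :
    ∃ K : ℝ, 0 < K ∧ ∀ T : Finset (Fin d → ℤ),
      P {ξ | ∀ x ∈ T, ¬ (ξ ∩ Kcube d K x).Nonempty} ≤ ENNReal.ofReal q ^ T.card := by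
  obtain ⟨K, hK, μ, ν, hμ, hν, hfst, hsnd, hdom⟩ := hA1 (1 - q) (by linarith) (by linarith)
  refine ⟨K, hK, fun T => ?_⟩
  set S : Set (Config d) := {ξ | ∀ x ∈ T, (ξ ∩ Kcube d K x).ncard = 0} with hS
  have hSm : MeasurableSet S := by
    have : S = ⋂ x ∈ T, {ξ : Config d | (ξ ∩ Kcube d K x).ncard = 0} := by
      ext ξ
      simp [hS]
    rw [this]
    exact Finset.measurableSet_biInter _ fun x _ => MeasurableSpace.measurableSet_generateFrom
      ⟨_, 0, isBounded_Kcube K x, measurableSet_Kcube K x, rfl⟩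
  set F : Set ((Fin d → ℤ) → Bool) := {ω | ∀ x ∈ T, ω x = false} with hF
  have hFm : MeasurableSet F := by
    have : F = ⋂ x ∈ T, (fun ω : (Fin d → ℤ) → Bool => ω x) ⁻¹' {false} := by
      ext ω
      simp [hF]
    rw [this]
    exact Finset.measurableSet_biInter _ fun x _ =>
      (measurableSet_singleton false).preimage (measurable_pi_apply x)
  have hfin : ∀ᵐ ω ∂μ, IsLocallyFinite ω.1 := by
    have h := hP.2
    rw [← hfst] at h
    exact ae_of_ae_map measurable_fst.aemeasurable h
  calc P {ξ | ∀ x ∈ T, ¬ (ξ ∩ Kcube d K x).Nonempty} ≤ P S := by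
        refine measure_mono fun ξ hξ x hx => ?_
        rw [Set.not_nonempty_iff_eq_empty.1 (hξ x hx), Set.ncard_empty]
    _ = μ (Prod.fst ⁻¹' S) := by rw [← hfst, Measure.map_apply measurable_fst hSm]
    _ ≤ μ (Prod.snd ⁻¹' F) := by
        refine measure_mono_ae ?_
        filter_upwards [hfin, hdom] with ω hω hωdom hωS x hx
        by_contra hne
        have hne' := hωdom x (by simpa using hne)
        exact (Set.ncard_pos (hω _ (isBounded_Kcube K x))).2 hne' |>.ne' (hωS x hx)
    _ = ν F := by rw [← hsnd, Measure.map_apply measurable_snd hFm]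
    _ = ENNReal.ofReal q ^ T.card := by
        rw [hF, hν.2 T fun _ => false]
        simp

/-- The site `x` is good when the corresponding box of the centred grid is occupied. -/
def goodSite (ξ : Config d) (K : ℝ) (m : ℕ) (x : Fin d → ℕ) : Prop :=
  (ξ ∩ Kcube d K fun i => (x i : ℤ) - m).Nonempty

/-- Half of the number of boxes along one side of `Λ_L`. -/
def halfSide (K : ℝ) (L : ℕ) : ℕ := ⌊(L : ℝ) / (2 * K)⌋₊

/-- Size above which connected sets are at least half fully good. -/
def clusterSize (d L : ℕ) : ℕ := ⌈(2 * d + 2 : ℝ) * Real.log L⌉₊ + 1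

/-- Side above which blocks contain a good site. -/
def blockSize (d L : ℕ) : ℕ := ⌈((d + 2 : ℝ) * Real.log L) ^ ((1 : ℝ) / d)⌉₊ + 1

theorem two_mul_halfSide_le {K : ℝ} (hK : 0 < K) (L : ℕ) :
    ((2 * halfSide K L : ℕ) : ℝ) ≤ L / K := by
  have h := Nat.floor_le (show 0 ≤ (L : ℝ) / (2 * K) by positivity)
  push_cast
  calc 2 * (halfSide K L : ℝ) ≤ 2 * ((L : ℝ) / (2 * K)) := by
        unfold halfSide; linarith
    _ = L / K := by field_simp

theorem ae_eventually_not_of_le {P : Measure (Config d)} {s : ℕ → Set (Config d)} (c : ℝ)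
    (hs : ∀ L, P (s L) ≤ ENNReal.ofReal (c * (1 / (L : ℝ) ^ 2))) :
    ∀ᵐ ξ ∂P, ∀ᶠ L in atTop, ξ ∉ s L := by
  refine ae_eventually_notMem (ne_top_of_le_ne_top ?_ (ENNReal.tsum_le_tsum hs))
  have h : Summable fun L : ℕ => c * (1 / (L : ℝ) ^ 2) :=
    (Real.summable_one_div_nat_pow.2 (by norm_num)).mul_left c
  exact h.tsum_ofReal_ne_top

/-- At a suitable scale the good sites are typically dense: large connected sets are at least half
fully good, and blocks of logarithmic volume contain good sites. -/
theorem exists_scale_eventually_good (hd : 2 ≤ d) {P : Measure (Config d)} (hP : IsPointProcess P)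
    (hA1 : AssumptionA1 P) :
    ∃ K : ℝ, 0 < K ∧ ∀ᵐ ξ ∂P, ∀ᶠ L : ℕ in atTop,
      (∀ X : Finset (Fin d → ℕ), X ⊆ gridBox d (2 * halfSide K L) → NearConn X →
        clusterSize d L ≤ X.card →
        X.card ≤ 2 * (fullyGood (goodSite ξ K (halfSide K L)) X).card) ∧
      ∀ z : Fin d → ℕ, (∀ i, z i + blockSize d L ≤ 2 * halfSide K L) →
        ∃ y ∈ blockSites z (blockSize d L), goodSite ξ K (halfSide K L) y := by
  have hθ0 := badRate_pos d
  have hq1 : badRate d ^ (2 * (d + 1)) ≤ Real.exp (-1) :=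
    (pow_le_of_le_one hθ0.le (badRate_lt_one d).le (by omega)).trans (badRate_le d)
  obtain ⟨K, hK, hPK⟩ := exists_scale hP hA1 (q := badRate d ^ (2 * (d + 1))) (by positivity)
    (pow_lt_one₀ hθ0.le (badRate_lt_one d) (by omega))
  refine ⟨K, hK, ?_⟩
  have hq : ∀ (m : ℕ) (T : Finset (Fin d → ℕ)), P {ξ | ∀ x ∈ T, ¬ goodSite ξ K m x} ≤
      ENNReal.ofReal (badRate d ^ (2 * (d + 1))) ^ T.card := by
    classical
    intro m T
    have hinj : Function.Injective fun (x : Fin d → ℕ) (i : Fin d) => (x i : ℤ) - m := by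
      intro x y hxy
      ext i
      have := congrFun hxy i
      simp only at this
      omega
    have h := hPK (T.image fun x i => (x i : ℤ) - m)
    rw [Finset.card_image_of_injective _ hinj] at h
    refine le_trans (measure_mono fun ξ hξ => ?_) h
    intro y hy
    obtain ⟨x, hx, rfl⟩ := Finset.mem_image.1 hy
    exact hξ x hx
  have h1 := ae_eventually_not_of_le (P := P) (K⁻¹ ^ (2 * d)) fun L =>
    (measure_exists_not_fullyGood_le P (fun ξ => goodSite ξ K (halfSide K L)) (hq _)
      (k := clusterSize d L) (by simp [clusterSize]) (2 * halfSide K L)).trans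
      (ENNReal.ofReal_le_ofReal (by
        rcases Nat.eq_zero_or_pos L with rfl | hL
        · have hd0 : d ≠ 0 := by omega
          simp [halfSide, hd0]
        have hL' : (0 : ℝ) < L := by exact_mod_cast hL
        have hexp : Real.exp (-(clusterSize d L : ℝ)) ≤ (L : ℝ)⁻¹ ^ (2 * d + 2) := by
          rw [inv_pow, ← Real.exp_log (pow_pos hL' (2 * d + 2)), ← Real.exp_neg, Real.exp_le_exp,
            Real.log_pow, neg_le_neg_iff]
          have := Nat.le_ceil ((2 * d + 2 : ℝ) * Real.log L)
          unfold clusterSize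
          push_cast
          linarith
        calc ((2 * halfSide K L : ℕ) : ℝ) ^ (2 * d) * Real.exp (-(clusterSize d L : ℝ))
            ≤ (L / K) ^ (2 * d) * (L : ℝ)⁻¹ ^ (2 * d + 2) := by
              gcongr
              exact two_mul_halfSide_le hK L
          _ = K⁻¹ ^ (2 * d) * (1 / (L : ℝ) ^ 2) := by
              rw [div_pow, inv_pow, inv_pow, pow_add]
              field_simp))
  have h2 := ae_eventually_not_of_le (P := P) (K⁻¹ ^ d) fun L =>
    (measure_exists_bad_block_le P (fun ξ => goodSite ξ K (halfSide K L)) (by positivity) (hq _)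
      (b := blockSize d L) (by simp [blockSize]) (2 * halfSide K L)).trans
      (ENNReal.ofReal_le_ofReal (by
        rcases Nat.eq_zero_or_pos L with rfl | hL
        · have hd0 : d ≠ 0 := by omega
          simp [halfSide, hd0]
        have hL' : (0 : ℝ) < L := by exact_mod_cast hL
        have hlog : 0 ≤ Real.log L := Real.log_natCast_nonneg L
        have hexp : (badRate d ^ (2 * (d + 1))) ^ blockSize d L ^ d ≤ (L : ℝ)⁻¹ ^ (d + 2) := by
          refine (pow_le_pow_left₀ (by positivity) hq1 _).trans ?_
          rw [inv_pow, ← Real.exp_log (pow_pos hL' (d + 2)), ← Real.exp_neg, ← Real.exp_nat_mul,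
            Real.exp_le_exp, Real.log_pow, mul_neg_one, neg_le_neg_iff]
          have hb : ((d + 2 : ℝ) * Real.log L) ^ ((1 : ℝ) / d) ≤ blockSize d L := by
            refine (Nat.le_ceil _).trans ?_
            unfold blockSize
            push_cast
            linarith
          have hpow := pow_le_pow_left₀ (Real.rpow_nonneg (by positivity) _) hb d
          rw [one_div, Real.rpow_inv_natCast_pow (by positivity) (by omega)] at hpow
          exact_mod_cast hpow
        calc ((2 * halfSide K L : ℕ) : ℝ) ^ d * (badRate d ^ (2 * (d + 1))) ^ blockSize d L ^ d
            ≤ (L / K) ^ d * (L : ℝ)⁻¹ ^ (d + 2) := by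
              gcongr
              exact two_mul_halfSide_le hK L
          _ = K⁻¹ ^ d * (1 / (L : ℝ) ^ 2) := by
              rw [div_pow, inv_pow, inv_pow, pow_add]
              field_simp))
  filter_upwards [h1, h2] with ξ hξ1 hξ2
  filter_upwards [hξ1, hξ2] with L hL1 hL2
  refine ⟨fun X hX hconn hcard => ?_, not_not.1 hL2⟩
  by_contra hbad
  exact hL1 ⟨X, hX, hconn, hcard, hbad⟩

theorem dist_le_of_forall_abs_sub_le {p q : Pt d} {r : ℝ} (hr : 0 ≤ r)
    (h : ∀ i, |p i - q i| ≤ r) : dist p q ≤ d * r := by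
  rw [EuclideanSpace.dist_eq, Real.sqrt_le_iff]
  refine ⟨by positivity, ?_⟩
  calc ∑ i, dist (p i) (q i) ^ 2 ≤ ∑ _i : Fin d, r ^ 2 :=
        Finset.sum_le_sum fun i _ => pow_le_pow_left₀ dist_nonneg (h i) 2
    _ = (d : ℝ) * r ^ 2 := by simp
    _ ≤ (d : ℝ) ^ 2 * r ^ 2 := by
        gcongr
        exact_mod_cast Nat.le_self_pow (by norm_num) d
    _ = (d * r) ^ 2 := by ring

/-- The site of the grid box containing `p`, where boundary points are moved to the grid. -/
def siteOf (K : ℝ) (m : ℕ) (p : Pt d) : Fin d → ℕ := fun i => min ⌊p i / K + m⌋₊ (2 * m - 1)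

theorem siteOf_lt {K : ℝ} {m : ℕ} (hm : 1 ≤ m) (p : Pt d) (i : Fin d) :
    siteOf K m p i < 2 * m := by
  have := min_le_right ⌊p i / K + m⌋₊ (2 * m - 1)
  unfold siteOf
  omega

theorem abs_sub_siteOf_le {K : ℝ} (hK : 0 < K) {m : ℕ} (hm : 1 ≤ m) {p : Pt d} {i : Fin d}
    (hp : |p i| ≤ K * (m + 1)) : |p i - K * ((siteOf K m p i : ℝ) - m)| ≤ 2 * K := by
  obtain ⟨u, hu⟩ : ∃ u, u = p i / K := ⟨_, rfl⟩
  have hpu : p i = K * u := by rw [hu]; field_simp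
  have hu1 : |u| ≤ m + 1 := by
    rw [hpu, abs_mul, abs_of_pos hK] at hp
    exact le_of_mul_le_mul_left hp hK
  obtain ⟨hl, hr⟩ := abs_le.1 hu1
  have hm1 : (1 : ℝ) ≤ m := by exact_mod_cast hm
  have hcast : ((2 * m - 1 : ℕ) : ℝ) = 2 * m - 1 := by
    rw [Nat.cast_sub (by omega)]
    push_cast
    ring
  suffices H : |u + m - siteOf K m p i| ≤ 2 by
    rw [show p i - K * ((siteOf K m p i : ℝ) - m) = K * (u + m - siteOf K m p i) by
      rw [hpu]; ring, abs_mul, abs_of_pos hK, mul_comm]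
    gcongr
  have hsite : (siteOf K m p i : ℝ) = min (⌊u + m⌋₊ : ℝ) (2 * m - 1) := by
    rw [siteOf, Nat.cast_min, hcast, hu]
  rw [hsite, abs_le]
  have h1 := Nat.lt_floor_add_one (u + m)
  rcases le_or_gt 0 (u + m) with h0 | h0
  · have h2 := Nat.floor_le h0
    constructor
    · have := min_le_left (⌊u + m⌋₊ : ℝ) (2 * m - 1)
      linarith
    · rcases min_choice (⌊u + m⌋₊ : ℝ) (2 * m - 1) with h | h <;> rw [h] <;> linarith
  · rw [Nat.floor_of_nonpos h0.le]
    have : min ((0 : ℕ) : ℝ) (2 * m - 1) = 0 := by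
      rw [Nat.cast_zero]
      exact min_eq_left (by linarith)
    rw [this]
    constructor <;> linarith

theorem siteOf_eq_of_mem_Kcube {K : ℝ} (hK : 0 < K) {m : ℕ} {p : Pt d} {x : Fin d → ℕ}
    (hx : ∀ i, x i < 2 * m) (hp : p ∈ Kcube d K fun i => (x i : ℤ) - m) : siteOf K m p = x := by
  ext i
  obtain ⟨h1, h2⟩ := hp i
  push_cast at h1 h2
  have h3 : (x i : ℝ) - m ≤ p i / K := by
    rw [le_div_iff₀ hK]; linarith
  have h4 : p i / K < (x i : ℝ) - m + 1 := by
    rw [div_lt_iff₀ hK]; linarith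
  have : ⌊p i / K + m⌋₊ = x i := by
    rw [Nat.floor_eq_iff (by linarith [(Nat.cast_nonneg (x i) : (0 : ℝ) ≤ x i)])]
    constructor <;> linarith
  rw [siteOf, this]
  have := hx i
  omega

theorem mem_cube_of_mem_Kcube {K L : ℝ} (hK : 0 < K) {m : ℕ} (hmL : K * m ≤ L / 2) {p : Pt d}
    {x : Fin d → ℕ} (hx : ∀ i, x i < 2 * m) (hp : p ∈ Kcube d K fun i => (x i : ℤ) - m) :
    p ∈ cube d L := by
  intro i
  obtain ⟨h1, h2⟩ := hp i
  push_cast at h1 h2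
  have h3 : (x i : ℝ) + 1 ≤ 2 * m := by exact_mod_cast hx i
  have h4 : (0 : ℝ) ≤ x i := Nat.cast_nonneg _
  rw [abs_le]
  constructor <;> nlinarith

/-- The index of the cell containing the site `x`; cells have side `s`, except that the last ones
are extended to fill the box `[0,N)^d`. -/
def cellOf (N s : ℕ) (x : Fin d → ℕ) : Fin d → ℕ := fun i => min (x i / s) (N / s - 1)

theorem mul_le_of_min_div_eq {n s k c : ℕ} (h : min (n / s) k = c) : c * s ≤ n := by
  rw [← h]
  exact (Nat.mul_le_mul_right s (min_le_left _ _)).trans (Nat.div_mul_le_self n s)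

theorem min_div_mid {n₁ n₂ s k c : ℕ} (h₁ : min (n₁ / s) k = c) (h₂ : min (n₂ / s) k = c) :
    min ((n₁ + n₂) / 2 / s) k = c := by
  wlog h : n₁ ≤ n₂ generalizing n₁ n₂
  · rw [add_comm]
    exact this h₂ h₁ (by omega)
  have ha : n₁ / s ≤ (n₁ + n₂) / 2 / s := Nat.div_le_div_right (by omega)
  have hb : (n₁ + n₂) / 2 / s ≤ n₂ / s := Nat.div_le_div_right (by omega)
  omega

theorem min_div_block {N n s b c : ℕ} (hs : 0 < s) (hbs : b ≤ s) (hsN : s ≤ N) (hn : n < N)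
    (hb : 1 ≤ b) (h : min (n / s) (N / s - 1) = c) :
    max (c * s) (n + 1 - b) + b ≤ N ∧ ∀ y, max (c * s) (n + 1 - b) ≤ y →
      y < max (c * s) (n + 1 - b) + b →
      min (y / s) (N / s - 1) = c ∧ y ≤ n + b ∧ n ≤ y + b := by
  have hcn := mul_le_of_min_div_eq h
  have hM : 1 ≤ N / s := (Nat.one_le_div_iff hs).2 hsN
  have hcN : (c + 1) * s ≤ N :=
    (Nat.mul_le_mul_right s (by omega : c + 1 ≤ N / s)).trans (Nat.div_mul_le_self N s)
  rw [add_mul, one_mul] at hcN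
  refine ⟨by omega, fun y hy1 hy2 => ⟨?_, by omega, by omega⟩⟩
  have h1 : c ≤ y / s := (Nat.le_div_iff_mul_le hs).2 (by omega)
  have h2 : y / s ≤ c ∨ y / s ≤ n / s := by
    by_cases hyn : y ≤ n
    · exact Or.inr (Nat.div_le_div_right hyn)
    · left
      rw [← Nat.lt_succ_iff, Nat.div_lt_iff_lt_mul hs, Nat.succ_mul]
      omega
  omega

/-- If blocks of side `b` contain points of `E`, each cell meeting both `U` and its complement
contains such a pair of points at distance of order `b`. -/
theorem exists_close_pair {E U : Finset (Pt d)} (hU : U ⊆ E) {K : ℝ} (hK : 0 < K) {m s b : ℕ}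
    (hm : 1 ≤ m) (hb : 1 ≤ b) (hbs : b ≤ s) (hsN : s ≤ 2 * m)
    (hEm : ∀ p ∈ E, ∀ i, |p i| ≤ K * (m + 1))
    (hblock : ∀ z : Fin d → ℕ, (∀ i, z i + b ≤ 2 * m) →
      ∃ y ∈ blockSites z b, ∃ p ∈ E, siteOf K m p = y)
    {c : Fin d → ℕ} (hmix : (∃ u ∈ U, cellOf (2 * m) s (siteOf K m u) = c) ∧
      ∃ v ∈ E \ U, cellOf (2 * m) s (siteOf K m v) = c) :
    ∃ u ∈ U, ∃ v ∈ E \ U, cellOf (2 * m) s (siteOf K m u) = c ∧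
      cellOf (2 * m) s (siteOf K m v) = c ∧ dist u v ≤ 2 * (d * (K * (b + 5))) := by
  classical
  set S := (U ×ˢ (E \ U)).filter fun p => cellOf (2 * m) s (siteOf K m p.1) = c ∧
    cellOf (2 * m) s (siteOf K m p.2) = c with hS
  have hSne : S.Nonempty := by
    obtain ⟨⟨u, hu, huc⟩, v, hv, hvc⟩ := hmix
    exact ⟨(u, v), Finset.mem_filter.2 ⟨Finset.mem_product.2 ⟨hu, hv⟩, huc, hvc⟩⟩
  obtain ⟨⟨u, v⟩, huvS, hmin⟩ := Finset.exists_min_image S (fun p => dist p.1 p.2) hSne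
  obtain ⟨huv, huc, hvc⟩ := Finset.mem_filter.1 huvS
  obtain ⟨hu, hv⟩ := Finset.mem_product.1 huv
  simp only at huc hvc hu hv hmin
  refine ⟨u, hu, v, hv, huc, hvc, ?_⟩
  by_contra! hlt
  have hvE := (Finset.mem_sdiff.1 hv).1
  set n : Fin d → ℕ := fun i => (siteOf K m u i + siteOf K m v i) / 2 with hn
  have hnc : ∀ i, min (n i / s) (2 * m / s - 1) = c i := fun i =>
    min_div_mid (congrFun huc i) (congrFun hvc i)
  have hnN : ∀ i, n i < 2 * m := fun i => by
    have h1 := siteOf_lt (K := K) hm u i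
    have h2 := siteOf_lt (K := K) hm v i
    simp only [hn]
    omega
  have hbl := fun i => min_div_block (by omega) hbs hsN (hnN i) hb (hnc i)
  obtain ⟨y, hy, w, hw, hwy⟩ := hblock (fun i => max (c i * s) (n i + 1 - b)) fun i => (hbl i).1
  have hy' := fun i => (hbl i).2 (y i) (mem_blockSites.1 hy i).1 (mem_blockSites.1 hy i).2
  have hwc : cellOf (2 * m) s (siteOf K m w) = c := by
    rw [hwy]
    exact funext fun i => (hy' i).1
  have hwq : dist w (midpoint ℝ u v) ≤ d * (K * (b + 5)) := by
    refine dist_le_of_forall_abs_sub_le (by positivity) fun i => ?_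
    have hq : (midpoint ℝ u v) i = (u i + v i) / 2 := by
      rw [midpoint_eq_smul_add]
      simp
      ring
    have h1 := abs_sub_siteOf_le hK hm (hEm w hw i)
    have h2 := abs_sub_siteOf_le hK hm (hEm u (hU hu) i)
    have h3 := abs_sub_siteOf_le hK hm (hEm v hvE i)
    rw [hwy] at h1
    have h4 : (y i : ℝ) ≤ n i + b := by exact_mod_cast (hy' i).2.1
    have h5 : (n i : ℝ) ≤ y i + b := by exact_mod_cast (hy' i).2.2
    have h6 : (2 : ℝ) * n i ≤ siteOf K m u i + siteOf K m v i := by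
      exact_mod_cast (by simp only [hn]; omega : 2 * n i ≤ siteOf K m u i + siteOf K m v i)
    have h7 : (siteOf K m u i : ℝ) + siteOf K m v i ≤ 2 * n i + 1 := by
      exact_mod_cast (by simp only [hn]; omega : siteOf K m u i + siteOf K m v i ≤ 2 * n i + 1)
    rw [hq]
    rw [abs_le] at h1 h2 h3 ⊢
    constructor <;> nlinarith
  have hqu : dist (midpoint ℝ u v) u = dist u v / 2 := by
    rw [dist_midpoint_left]
    simp
    ring
  have hqv : dist (midpoint ℝ u v) v = dist u v / 2 := by
    rw [dist_midpoint_right]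
    simp
    ring
  by_cases hwU : w ∈ U
  · have h := hmin (w, v) (Finset.mem_filter.2 ⟨Finset.mem_product.2 ⟨hwU, hv⟩, hwc, hvc⟩)
    have := dist_triangle w (midpoint ℝ u v) v
    simp only at h
    linarith
  · have h := hmin (u, w) (Finset.mem_filter.2
      ⟨Finset.mem_product.2 ⟨hu, Finset.mem_sdiff.2 ⟨hw, hwU⟩⟩, huc, hwc⟩)
    have := dist_triangle w (midpoint ℝ u v) u
    simp only at h
    rw [dist_comm u w] at h
    linarith

theorem rate_nonneg (α : ℝ) (x y : Pt d) : 0 ≤ rate α x y := (Real.exp_pos _).le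

/-- The total rate between `U` and its complement is bounded below by the number of close pairs. -/
theorem card_mul_exp_le_cut {α : ℝ} (hα : 0 ≤ α) {ι : Type*} (S : Finset ι) {R : ℝ}
    {E U : Finset (Pt d)} {β : Type*} (key : Pt d → Pt d → β) (lab : ι → β)
    (hlab : Set.InjOn lab S)
    (h : ∀ c ∈ S, ∃ u ∈ U, ∃ v ∈ E \ U, key u v = lab c ∧ dist u v ≤ R) :
    S.card * Real.exp (-R ^ α) ≤ ∑ x ∈ U, ∑ y ∈ E \ U, rate α x y := by
  classical
  choose! u hu v hv hkey hdist using h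
  have hinj : Set.InjOn (fun c => (u c, v c)) S := by
    intro a ha b hb hab
    simp only [Prod.mk.injEq] at hab
    apply hlab ha hb
    rw [← hkey a ha, ← hkey b hb, hab.1, hab.2]
  rw [← Finset.sum_product', ← Finset.card_image_of_injOn hinj, ← nsmul_eq_mul, ← Finset.sum_const]
  have hsub : S.image (fun c => (u c, v c)) ⊆ U ×ˢ (E \ U) := by
    intro p hp
    obtain ⟨c, hc, rfl⟩ := Finset.mem_image.1 hp
    exact Finset.mem_product.2 ⟨hu c hc, hv c hc⟩
  refine (Finset.sum_le_sum fun p hp => ?_).trans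
    (Finset.sum_le_sum_of_subset_of_nonneg hsub fun p _ _ => rate_nonneg α p.1 p.2)
  obtain ⟨c, hc, rfl⟩ := Finset.mem_image.1 hp
  refine Real.exp_le_exp.2 (neg_le_neg ?_)
  exact Real.rpow_le_rpow dist_nonneg (hdist c hc) hα

theorem cellOf_mem_gridBox {N s : ℕ} (hs : 1 ≤ s) (hsN : s ≤ N) (x : Fin d → ℕ) :
    cellOf N s x ∈ gridBox d (N / s) := by
  have hM : 1 ≤ N / s := (Nat.one_le_div_iff hs).2 hsN
  refine mem_gridBox.2 fun i => ?_
  unfold cellOf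
  omega

theorem add_le_of_mem_gridBox {N s : ℕ} {c : Fin d → ℕ} (hc : c ∈ gridBox d (N / s)) (i : Fin d) :
    c i * s + s ≤ N := by
  have := mem_gridBox.1 hc i
  calc c i * s + s = (c i + 1) * s := by ring
    _ ≤ N / s * s := Nat.mul_le_mul_right s this
    _ ≤ N := Nat.div_mul_le_self N s

theorem cellOf_eq_of_mem_blockSites {N s : ℕ} {c x : Fin d → ℕ} (hc : c ∈ gridBox d (N / s))
    (hx : x ∈ blockSites (fun i => c i * s) s) : cellOf N s x = c := by
  ext i
  have hxi := mem_blockSites.1 hx i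
  have hci := mem_gridBox.1 hc i
  have : x i / s = c i := Nat.div_eq_of_lt_le hxi.1 (by rw [Nat.succ_mul]; exact hxi.2)
  simp only [cellOf, this]
  omega

theorem card_mul_pow_le_of_blocks {N s : ℕ} {T Q : Finset (Fin d → ℕ)}
    (hT : T ⊆ gridBox d (N / s))
    (h : ∀ c ∈ T, blockSites (fun i => c i * s) s ⊆ Q) : T.card * s ^ d ≤ Q.card := by
  classical
  have hdisj : Set.PairwiseDisjoint (T : Set (Fin d → ℕ))
      fun c => blockSites (fun i => c i * s) s := by
    intro c hc c' hc' hne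
    refine Finset.disjoint_left.2 fun x hx hx' => hne ?_
    rw [← cellOf_eq_of_mem_blockSites (hT hc) hx, cellOf_eq_of_mem_blockSites (hT hc') hx']
  have hcard := Finset.card_le_card (Finset.biUnion_subset.2 h)
  rw [Finset.card_biUnion hdisj] at hcard
  simpa [card_blockSites] using hcard

/-- Two points whose sites are adjacent. -/
theorem dist_le_of_siteOf_adjacent {K : ℝ} (hK : 0 < K) {m : ℕ} (hm : 1 ≤ m) {p q : Pt d}
    (hp : ∀ i, |p i| ≤ K * (m + 1)) (hq : ∀ i, |q i| ≤ K * (m + 1)) {i : Fin d}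
    (h : siteOf K m q = siteOf K m p + Pi.single i 1) : dist p q ≤ d * (5 * K) := by
  refine dist_le_of_forall_abs_sub_le (by positivity) fun j => ?_
  have h1 := abs_sub_siteOf_le hK hm (hp j)
  have h2 := abs_sub_siteOf_le hK hm (hq j)
  have h3 : (siteOf K m p j : ℝ) ≤ siteOf K m q j ∧
      (siteOf K m q j : ℝ) ≤ siteOf K m p j + 1 := by
    rw [h]
    by_cases hj : j = i
    · subst hj; simp
    · simp [hj]
  rw [abs_le] at h1 h2 ⊢
  constructor <;> nlinarith

/-- Lower bounds for the total rate out of `U` in terms of the cells meeting both `U` and its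
complement, and of the volume of a coloured region. -/
theorem exists_cut_lower_bounds (hd : 2 ≤ d) {α : ℝ} (hα : 0 ≤ α) {E U : Finset (Pt d)}
    (hU : U ⊆ E) {K : ℝ} (hK : 0 < K) {m s b k : ℕ} (hm : 1 ≤ m) (hb : 1 ≤ b) (hbs : b ≤ s)
    (hsN : s ≤ 2 * m) (hEm : ∀ p ∈ E, ∀ i, |p i| ≤ K * (m + 1)) {G : (Fin d → ℕ) → Prop}
    (hEG : ∀ x : Fin d → ℕ, (∀ i, x i < 2 * m) → G x → ∃ p ∈ E, siteOf K m p = x)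
    (hG : ∀ X : Finset (Fin d → ℕ), X ⊆ gridBox d (2 * m) → NearConn X → k ≤ X.card →
      X.card ≤ 2 * (fullyGood G X).card)
    (hblock : ∀ z : Fin d → ℕ, (∀ i, z i + b ≤ 2 * m) → ∃ y ∈ blockSites z b, G y)
    (hks : (k : ℝ) ≤ isoConst d * (s : ℝ) ^ (d - 1)) {f : Pt d → ℝ} (hf : ∀ p, 0 ≤ f p)
    {B : ℝ} (hB : 0 ≤ B)
    (hcell : ∀ c : Fin d → ℕ,
      ∑ p ∈ E.filter (fun p => cellOf (2 * m) s (siteOf K m p) = c), f p ≤ B * (s : ℝ) ^ d) :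
    ∃ M a : ℝ, 0 ≤ M ∧ 0 ≤ a ∧
      min (∑ p ∈ U, f p) (∑ p ∈ E \ U, f p) ≤ B * (s : ℝ) ^ d * M + B * a ∧
      M * Real.exp (-(2 * (d * (K * (b + 5)))) ^ α) ≤ ∑ x ∈ U, ∑ y ∈ E \ U, rate α x y ∧
      isoConst d * a ^ (((d : ℝ) - 1) / d) * Real.exp (-(d * (5 * K)) ^ α) ≤
        2 * ∑ x ∈ U, ∑ y ∈ E \ U, rate α x y := by
  classical
  have hs : 1 ≤ s := hb.trans hbs
  have hsite : ∀ z : Fin d → ℕ, (∀ i, z i + b ≤ 2 * m) →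
      ∃ y ∈ blockSites z b, ∃ p ∈ E, siteOf K m p = y := by
    intro z hz
    obtain ⟨y, hy, hGy⟩ := hblock z hz
    refine ⟨y, hy, hEG y (fun i => ?_) hGy⟩
    have h1 := mem_blockSites.1 hy i
    have h2 := hz i
    omega
  set cell : Pt d → Fin d → ℕ := fun p => cellOf (2 * m) s (siteOf K m p) with hcelldef
  set I := gridBox d (2 * m / s) with hI
  have hcellI : ∀ p, cell p ∈ I := fun p => cellOf_mem_gridBox hs hsN _
  set mixed := I.filter fun c => (∃ u ∈ U, cell u = c) ∧ ∃ v ∈ E \ U, cell v = c with hmixed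
  set pureU := I.filter fun c => ¬ ∃ v ∈ E \ U, cell v = c with hpureU
  set pureV := I.filter fun c => ¬ ∃ u ∈ U, cell u = c with hpureV
  set A : (Fin d → ℕ) → ZMod 2 := fun x =>
    if (∃ p ∈ U, siteOf K m p = x) ∨ ¬ ∃ v ∈ E \ U, cell v = cellOf (2 * m) s x then 1 else 0
    with hA
  obtain ⟨A', hiso, hA'⟩ := exists_cleaned_coloring hd hG hks A
  have hblockN : ∀ c ∈ I, blockSites (fun i => c i * s) s ⊆ gridBox d (2 * m) := by
    intro c hc x hx
    refine mem_gridBox.2 fun i => ?_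
    have h1 := mem_blockSites.1 hx i
    have h2 := add_le_of_mem_gridBox hc i
    omega
  have hAA' : ∀ c ∈ I, ∀ e : ZMod 2, (∀ x ∈ blockSites (fun i => c i * s) s, A x = e) →
      blockSites (fun i => c i * s) s ⊆ (gridBox d (2 * m)).filter fun x => A' x = e := by
    intro c hc e he x hx
    refine Finset.mem_filter.2 ⟨hblockN c hc hx, ?_⟩
    rw [hA' (fun i => c i * s) (fun i => add_le_of_mem_gridBox hc i) ?_ x (mem_blockSites.1 hx)]
    · exact he x hx
    · intro y hy
      rw [he y (mem_blockSites.2 hy), he _ (mem_blockSites.2 fun i => ⟨le_rfl, by omega⟩)]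
  have hpure1 : pureU.card * s ^ d ≤ ((gridBox d (2 * m)).filter fun x => A' x = 1).card := by
    refine card_mul_pow_le_of_blocks (Finset.filter_subset _ _) fun c hc => ?_
    obtain ⟨hcI, hc⟩ := Finset.mem_filter.1 hc
    refine hAA' c hcI 1 fun x hx => ?_
    simp only [hA]
    rw [if_pos]
    right
    rwa [cellOf_eq_of_mem_blockSites hcI hx]
  have hpure0 : pureV.card * s ^ d ≤ ((gridBox d (2 * m)).filter fun x => A' x = 0).card := by
    refine card_mul_pow_le_of_blocks (Finset.filter_subset _ _) fun c hc => ?_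
    obtain ⟨hcI, hc⟩ := Finset.mem_filter.1 hc
    refine hAA' c hcI 0 fun x hx => ?_
    simp only [hA]
    rw [if_neg]
    have hxc := cellOf_eq_of_mem_blockSites hcI hx
    rintro (⟨p, hp, hpx⟩ | h)
    · exact hc ⟨p, hp, by simp only [hcelldef, hpx, hxc]⟩
    · apply h
      obtain ⟨y, hy, p, hp, hpy⟩ := hsite (fun i => c i * s) fun i => by
        have := add_le_of_mem_gridBox hcI i
        omega
      have hyc : y ∈ blockSites (fun i => c i * s) s := by
        refine mem_blockSites.2 fun i => ?_
        have := mem_blockSites.1 hy i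
        omega
      have hpc : cell p = c := by
        simp only [hcelldef, hpy]
        exact cellOf_eq_of_mem_blockSites hcI hyc
      refine ⟨p, Finset.mem_sdiff.2 ⟨hp, fun hpU => hc ⟨p, hpU, hpc⟩⟩, ?_⟩
      rw [hpc, hxc]
  have hsum : ∀ (V : Finset (Pt d)) (T : Finset (Fin d → ℕ)), V ⊆ E →
      (∀ p ∈ V, cell p ∈ mixed ∪ T) →
      ∑ p ∈ V, f p ≤ B * (s : ℝ) ^ d * mixed.card + B * ((T.card * s ^ d : ℕ) : ℝ) := by
    intro V T hVE hV
    rw [← Finset.sum_fiberwise_of_maps_to hV]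
    calc ∑ c ∈ mixed ∪ T, ∑ p ∈ V.filter (fun p => cell p = c), f p
        ≤ ∑ _c ∈ mixed ∪ T, B * (s : ℝ) ^ d := by
          refine Finset.sum_le_sum fun c _ => le_trans ?_ (hcell c)
          exact Finset.sum_le_sum_of_subset_of_nonneg (Finset.filter_subset_filter _ hVE)
            fun p _ _ => hf p
      _ = ((mixed ∪ T).card : ℝ) * (B * (s : ℝ) ^ d) := by rw [Finset.sum_const, nsmul_eq_mul]
      _ ≤ ((mixed.card : ℝ) + T.card) * (B * (s : ℝ) ^ d) := by
          gcongr
          exact_mod_cast Finset.card_union_le _ _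
      _ = _ := by push_cast; ring
  have hsumU := hsum U pureU hU fun p hp => by
    by_cases h : ∃ v ∈ E \ U, cell v = cell p
    · exact Finset.mem_union_left _ (Finset.mem_filter.2 ⟨hcellI p, ⟨p, hp, rfl⟩, h⟩)
    · exact Finset.mem_union_right _ (Finset.mem_filter.2 ⟨hcellI p, h⟩)
  have hsumV := hsum (E \ U) pureV Finset.sdiff_subset fun p hp => by
    by_cases h : ∃ u ∈ U, cell u = cell p
    · exact Finset.mem_union_left _ (Finset.mem_filter.2 ⟨hcellI p, h, ⟨p, hp, rfl⟩⟩)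
    · exact Finset.mem_union_right _ (Finset.mem_filter.2 ⟨hcellI p, h⟩)
  refine ⟨mixed.card, min (((gridBox d (2 * m)).filter fun x => A' x = 0).card : ℝ)
    (((gridBox d (2 * m)).filter fun x => A' x = 1).card : ℝ), by positivity, by positivity,
    ?_, ?_, ?_⟩
  · rcases le_total (((gridBox d (2 * m)).filter fun x => A' x = 0).card : ℝ)
      (((gridBox d (2 * m)).filter fun x => A' x = 1).card : ℝ) with h | h
    · rw [min_eq_left h]
      refine (min_le_right _ _).trans (hsumV.trans ?_)
      gcongr
    · rw [min_eq_right h]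
      refine (min_le_left _ _).trans (hsumU.trans ?_)
      gcongr
  · refine card_mul_exp_le_cut hα mixed (fun u _ => cell u) id Function.injective_id.injOn ?_
    intro c hc
    obtain ⟨u, hu, v, hv, huc, -, huv⟩ :=
      exists_close_pair hU hK hm hb hbs hsN hEm hsite (Finset.mem_filter.1 hc).2
    exact ⟨u, hu, v, hv, huc, huv⟩
  · have hcut : (fullyGood G (bdrySites (2 * m) A)).card * Real.exp (-(d * (5 * K)) ^ α) ≤
        ∑ x ∈ U, ∑ y ∈ E \ U, rate α x y := by
      refine card_mul_exp_le_cut hα _ (fun u v => siteOf K m u ⊓ siteOf K m v) id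
        Function.injective_id.injOn ?_
      intro x hx
      obtain ⟨hxb, hGx, hGi⟩ := Finset.mem_filter.1 hx
      obtain ⟨hxN, i, hi, hne⟩ := mem_bdrySites.1 hxb
      have hxN' : ∀ j, (x + Pi.single i 1 : Fin d → ℕ) j < 2 * m := by
        intro j
        by_cases hj : j = i
        · subst hj; simpa using hi
        · simpa [hj] using hxN j
      have hone : ∀ y : Fin d → ℕ, (∀ j, y j < 2 * m) → G y → A y = 1 →
          ∃ p ∈ U, siteOf K m p = y := by
        intro y hyN hGy hAy
        by_contra hcon
        obtain ⟨p, hp, hpy⟩ := hEG y hyN hGy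
        have hpV : p ∈ E \ U := Finset.mem_sdiff.2 ⟨hp, fun hpU => hcon ⟨p, hpU, hpy⟩⟩
        simp only [hA] at hAy
        rw [if_neg] at hAy
        · exact zero_ne_one hAy
        · rintro (h | h)
          · exact hcon h
          · exact h ⟨p, hpV, by simp only [hcelldef, hpy]⟩
      have hzero : ∀ y : Fin d → ℕ, (∀ j, y j < 2 * m) → G y → A y ≠ 1 →
          ∃ p ∈ E \ U, siteOf K m p = y := by
        intro y hyN hGy hAy
        obtain ⟨p, hp, hpy⟩ := hEG y hyN hGy
        refine ⟨p, Finset.mem_sdiff.2 ⟨hp, fun hpU => hAy ?_⟩, hpy⟩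
        simp only [hA]
        exact if_pos (Or.inl ⟨p, hpU, hpy⟩)
      have hz2 : ∀ u v : ZMod 2, u ≠ v → u ≠ 1 → v = 1 := by decide
      have hle : x ≤ x + Pi.single i 1 := le_self_add
      by_cases hAx : A x = 1
      · obtain ⟨u, hu, hux⟩ := hone x hxN hGx hAx
        obtain ⟨v, hv, hvx⟩ := hzero _ hxN' (hGi i) fun h => hne (h.trans hAx.symm)
        refine ⟨u, hu, v, hv, ?_, ?_⟩
        · simp only [hux, hvx, id]
          exact inf_eq_left.2 hle
        · exact dist_le_of_siteOf_adjacent hK hm (hEm u (hU hu))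
            (hEm v (Finset.mem_sdiff.1 hv).1) (by rw [hux, hvx])
      · obtain ⟨u, hu, hux⟩ := hone _ hxN' (hGi i) (hz2 _ _ hne.symm hAx)
        obtain ⟨v, hv, hvx⟩ := hzero x hxN hGx hAx
        refine ⟨u, hu, v, hv, ?_, ?_⟩
        · simp only [hux, hvx, id]
          exact inf_eq_right.2 hle
        · rw [dist_comm]
          exact dist_le_of_siteOf_adjacent hK hm (hEm v (Finset.mem_sdiff.1 hv).1)
            (hEm u (hU hu)) (by rw [hux, hvx])
    calc _ ≤ (2 * (fullyGood G (bdrySites (2 * m) A)).card) *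
          Real.exp (-(d * (5 * K)) ^ α) := by gcongr
      _ ≤ _ := by rw [mul_assoc]; gcongr

theorem rate_self {α : ℝ} (hα : 0 < α) (x : Pt d) : rate α x x = 1 := by
  simp [rate, Real.zero_rpow hα.ne']

theorem sum_rate_eq {α : ℝ} (hα : 0 < α) {E : Finset (Pt d)} {x : Pt d} (hx : x ∈ E) :
    ∑ z ∈ E, rate α x z = 1 + ∑ z ∈ E.erase x, rate α x z := by
  rw [← Finset.add_sum_erase E _ hx, rate_self hα]

theorem wgt_nonneg (α : ℝ) (E : Finset (Pt d)) (i : ℕ) (x : Pt d) : 0 ≤ wgt α E i x := by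
  have h : 0 ≤ ∑ z ∈ E.erase x, rate α x z := Finset.sum_nonneg fun z _ => rate_nonneg α x z
  unfold wgt
  split_ifs
  · exact zero_le_one
  · exact h
  · exact le_max_of_le_right h

theorem wgt_le_sum_rate {α : ℝ} (hα : 0 < α) {E : Finset (Pt d)} (i : ℕ) {x : Pt d} (hx : x ∈ E) :
    wgt α E i x ≤ ∑ z ∈ E, rate α x z := by
  have h : 0 ≤ ∑ z ∈ E.erase x, rate α x z := Finset.sum_nonneg fun z _ => rate_nonneg α x z
  rw [sum_rate_eq hα hx]
  unfold wgt
  split_ifs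
  · linarith
  · linarith
  · exact max_le (by linarith) (by linarith)

theorem wgt_pos {α : ℝ} {E : Finset (Pt d)} (hE : 2 ≤ E.card) (i : ℕ) {x : Pt d} (hx : x ∈ E) :
    0 < wgt α E i x := by
  unfold wgt
  split_ifs
  · exact zero_lt_one
  · refine Finset.sum_pos (fun z _ => Real.exp_pos _) (Finset.card_pos.1 ?_)
    rw [Finset.card_erase_of_mem hx]
    omega
  · exact lt_max_of_lt_left zero_lt_one

theorem sum_le_tsum_of_subset {X : Type*} {F : Finset X} {A : Set X} (h : (F : Set X) ⊆ A)
    (f : X → ℝ≥0∞) : ∑ x ∈ F, f x ≤ ∑' x : A, f x := by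
  rw [← Finset.tsum_subtype]
  exact ENNReal.tsum_mono_subtype f h

theorem sum_rate_le_of_Rfun_le {α : ℝ} {ξ : Config d} {E F : Finset (Pt d)} {V : Set (Pt d)}
    (hE : (E : Set (Pt d)) ⊆ ξ) (hF : (F : Set (Pt d)) ⊆ ξ ∩ V) {r : ℝ} (hr : 0 ≤ r)
    (hR : Rfun α V ξ ≤ ENNReal.ofReal r) : ∑ x ∈ F, ∑ z ∈ E, rate α x z ≤ r := by
  rw [← ENNReal.ofReal_le_ofReal_iff hr]
  refine le_trans ?_ hR
  rw [ENNReal.ofReal_sum_of_nonneg fun x _ => Finset.sum_nonneg fun z _ => rate_nonneg α x z]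
  refine le_trans (Finset.sum_le_sum fun x _ => ?_) (sum_le_tsum_of_subset hF fun x =>
    ∑' y : ξ, ENNReal.ofReal (Real.exp (-(dist x (y : Pt d)) ^ α)))
  rw [ENNReal.ofReal_sum_of_nonneg fun z _ => rate_nonneg α x z]
  exact sum_le_tsum_of_subset hE fun z => ENNReal.ofReal (Real.exp (-(dist x z) ^ α))

theorem lt_of_min_div_eq {n N s c : ℕ} (hs : 0 < s) (hn : n < N)
    (h : min (n / s) (N / s - 1) = c) : n < c * s + 2 * s := by
  have h1 := Nat.lt_div_mul_add (a := n) hs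
  have h2 := Nat.lt_div_mul_add (a := N) hs
  rcases min_choice (n / s) (N / s - 1) with h' | h'
  · rw [h'] at h
    rw [h] at h1
    omega
  · rw [h'] at h
    have h3 : N / s * s ≤ (c + 1) * s := Nat.mul_le_mul_right s (by omega)
    rw [add_mul, one_mul] at h3
    omega

/-- Constant in the bound for the total weight of a cell. -/
def cellConst (d : ℕ) (K C : ℝ) : ℝ := (⌈6 * K⌉₊ + 2 : ℝ) ^ d * C * 2 ^ d

theorem cellConst_pos {K C : ℝ} (hC : 0 < C) : 0 < cellConst d K C := by
  unfold cellConst; positivity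

/-- Assumption (A2) bounds the total weight of each cell by its volume. -/
theorem sum_wgt_cell_le {α : ℝ} (hα : 0 < α) {ξ : Config d} {E : Finset (Pt d)} {L : ℕ}
    (hE : (E : Set (Pt d)) ⊆ ξ) (hEL : (E : Set (Pt d)) ⊆ cube d L) {η C : ℝ} (hC : 0 < C)
    (hR : ∀ x : Fin d → ℤ, (Vcube d L η x ∩ cube d L).Nonempty →
      Rfun α (Vcube d L η x) ξ ≤ ENNReal.ofReal (C * (L : ℝ) ^ (η * d)))
    {K : ℝ} (hK : 0 < K) {m s : ℕ} (hm : 1 ≤ m) (hs : 1 ≤ s)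
    (hEm : ∀ p ∈ E, ∀ i, |p i| ≤ K * (m + 1)) (hsL : (s : ℝ) ≤ (L : ℝ) ^ η)
    (hLs : (L : ℝ) ^ η ≤ 2 * s) (i : ℕ) (c : Fin d → ℕ) :
    ∑ p ∈ E.filter (fun p => cellOf (2 * m) s (siteOf K m p) = c), wgt α E i p ≤
      cellConst d K C * (s : ℝ) ^ d := by
  classical
  have hs0 : (0 : ℝ) < s := by exact_mod_cast hs
  have hs1 : (1 : ℝ) ≤ s := by exact_mod_cast hs
  obtain ⟨l, hl⟩ : ∃ l, l = (L : ℝ) ^ η := ⟨_, rfl⟩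
  have hl0 : 0 < l := by rw [hl]; linarith
  have hLd : (L : ℝ) ^ (η * d) = l ^ d := by
    rw [hl, Real.rpow_mul (Nat.cast_nonneg L), Real.rpow_natCast]
  set F := E.filter (fun p => cellOf (2 * m) s (siteOf K m p) = c) with hF
  set v : Pt d → Fin d → ℤ := fun p j => ⌊p j / l⌋ with hv
  set lo : Fin d → ℝ := fun j => K * ((c j * s : ℕ) - m) - 2 * K with hlo
  set T : Finset (Fin d → ℤ) := Fintype.piFinset fun j =>
    Finset.Icc ⌊lo j / l⌋ (⌊lo j / l⌋ + (⌈6 * K⌉₊ + 1 : ℕ)) with hT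
  have hTcard : T.card = (⌈6 * K⌉₊ + 2) ^ d := by
    rw [hT, Fintype.card_piFinset]
    have : ∀ j : Fin d, (Finset.Icc ⌊lo j / l⌋ (⌊lo j / l⌋ + (⌈6 * K⌉₊ + 1 : ℕ))).card =
        ⌈6 * K⌉₊ + 2 := by
      intro j
      rw [Int.card_Icc]
      omega
    simp only [this, Finset.prod_const, Finset.card_univ, Fintype.card_fin]
  have hvT : ∀ p ∈ F, v p ∈ T := by
    intro p hp
    obtain ⟨hpE, hpc⟩ := Finset.mem_filter.1 hp
    refine Fintype.mem_piFinset.2 fun j => Finset.mem_Icc.2 ?_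
    have hcj := congrFun hpc j
    have h1 : ((c j * s : ℕ) : ℝ) ≤ siteOf K m p j := by
      exact_mod_cast mul_le_of_min_div_eq hcj
    have h2 : (siteOf K m p j : ℝ) + 1 ≤ (c j * s : ℕ) + 2 * s := by
      exact_mod_cast lt_of_min_div_eq (by omega) (siteOf_lt hm p j) hcj
    obtain ⟨h3, h4⟩ := abs_le.1 (abs_sub_siteOf_le hK hm (hEm p hpE j))
    have h5 : lo j ≤ p j := by simp only [hlo]; nlinarith
    have h6 : p j ≤ lo j + 6 * K * l := by
      have h7 : p j ≤ lo j + 6 * K * s := by simp only [hlo]; nlinarith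
      have : 6 * K * s ≤ 6 * K * l := by rw [hl]; gcongr
      linarith
    refine ⟨Int.floor_le_floor (by gcongr), Int.floor_le_iff.2 ?_⟩
    have h8 : p j / l ≤ lo j / l + 6 * K := by
      rw [div_le_iff₀ hl0, add_mul, div_mul_cancel₀ _ hl0.ne']
      exact h6
    have h9 := Int.lt_floor_add_one (lo j / l)
    have h10 := Nat.le_ceil (6 * K)
    push_cast
    linarith
  calc ∑ p ∈ F, wgt α E i p ≤ ∑ p ∈ F, ∑ z ∈ E, rate α p z :=
        Finset.sum_le_sum fun p hp => wgt_le_sum_rate hα i (Finset.mem_filter.1 hp).1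
    _ = ∑ x ∈ T, ∑ p ∈ F.filter (fun p => v p = x), ∑ z ∈ E, rate α p z :=
        (Finset.sum_fiberwise_of_maps_to hvT _).symm
    _ ≤ ∑ _x ∈ T, C * l ^ d := by
        refine Finset.sum_le_sum fun x _ => ?_
        rcases (F.filter fun p => v p = x).eq_empty_or_nonempty with h | ⟨p₀, hp₀⟩
        · rw [h, Finset.sum_empty]
          positivity
        have hVmem : ∀ p ∈ F.filter (fun p => v p = x), p ∈ Vcube d L η x := by
          intro p hp j
          have hpx : ⌊p j / l⌋ = x j := congrFun (Finset.mem_filter.1 hp).2 j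
          rw [← hl, ← hpx]
          have h1 := (le_div_iff₀ hl0).1 (Int.floor_le (p j / l))
          have h2 := (div_lt_iff₀ hl0).1 (Int.lt_floor_add_one (p j / l))
          constructor <;> linarith
        have hmemE : ∀ p ∈ F.filter (fun p => v p = x), p ∈ E := fun p hp =>
          (Finset.mem_filter.1 (Finset.mem_filter.1 hp).1).1
        refine sum_rate_le_of_Rfun_le hE (V := Vcube d L η x)
          (fun p hp => ⟨hE (hmemE p hp), hVmem p hp⟩) (by positivity) ?_
        rw [← hLd]
        exact hR x ⟨p₀, hVmem p₀ hp₀, hEL (hmemE p₀ hp₀)⟩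
    _ = (⌈6 * K⌉₊ + 2 : ℝ) ^ d * (C * l ^ d) := by
        rw [Finset.sum_const, nsmul_eq_mul, hTcard]
        push_cast
        rfl
    _ ≤ (⌈6 * K⌉₊ + 2 : ℝ) ^ d * (C * (2 * s) ^ d) := by
        rw [hl]
        gcongr
    _ = cellConst d K C * (s : ℝ) ^ d := by
        unfold cellConst
        ring

theorem Wsum_le {α : ℝ} {E : Finset (Pt d)} {i : ℕ} {K : ℝ} {m s : ℕ} (hs : 1 ≤ s)
    (hsN : s ≤ 2 * m) {B : ℝ} (hB : 0 ≤ B)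
    (hcell : ∀ c : Fin d → ℕ,
      ∑ p ∈ E.filter (fun p => cellOf (2 * m) s (siteOf K m p) = c), wgt α E i p ≤
        B * (s : ℝ) ^ d) :
    Wsum α E i E ≤ B * ((2 * m : ℕ) : ℝ) ^ d := by
  classical
  have hmaps : ∀ p ∈ E, cellOf (2 * m) s (siteOf K m p) ∈ gridBox d (2 * m / s) := fun p _ =>
    cellOf_mem_gridBox hs hsN _
  rw [Wsum, ← Finset.sum_fiberwise_of_maps_to hmaps]
  refine (Finset.sum_le_sum fun c _ => hcell c).trans ?_
  rw [Finset.sum_const, nsmul_eq_mul, card_gridBox]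
  calc (((2 * m / s) ^ d : ℕ) : ℝ) * (B * (s : ℝ) ^ d)
      = B * (((2 * m / s * s) ^ d : ℕ) : ℝ) := by push_cast; ring
    _ ≤ B * (((2 * m) ^ d : ℕ) : ℝ) := by
        refine mul_le_mul_of_nonneg_left ?_ hB
        exact_mod_cast Nat.pow_le_pow_left (Nat.div_mul_le_self (2 * m) s) d
    _ = _ := by push_cast; ring

/-- Constant in the isoperimetric lower bound. -/
def profileConst (d : ℕ) (α K B : ℝ) : ℝ :=
  min (1 / (2 * B)) (isoConst d * Real.exp (-(d * (5 * K)) ^ α) / 2 *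
    (1 / (2 * B) * (B * K⁻¹ ^ d / (2 * B)) ^ (-(1 : ℝ) / d)))

theorem profileConst_pos (hd : 2 ≤ d) {α K B : ℝ} (hK : 0 < K) (hB : 0 < B) :
    0 < profileConst d α K B := by
  have := isoConst_pos hd
  unfold profileConst
  positivity

theorem profile_mul_le_cut (hd : 2 ≤ d) {α K B : ℝ} (hK : 0 < K) (hB : 0 < B) {L η ε₀ : ℝ}
    (hL : 0 < L) (hη : η * (d + 1) = ε₀) {w t M a S r cut : ℝ} (hw : 0 < w) (ht : 0 < t)
    (hM : 0 ≤ M) (hS : S ≤ L ^ (η * d)) (h1 : w ≤ B * S * M + B * a)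
    (h2 : M * r ≤ cut) (hr : L ^ (-η) ≤ r)
    (h3 : isoConst d * a ^ (((d : ℝ) - 1) / d) * Real.exp (-(d * (5 * K)) ^ α) ≤ 2 * cut)
    (hwt : w ≤ t * (B * (L / K) ^ d)) :
    profileConst d α K B * min (L ^ (-ε₀)) (t ^ (-(1 : ℝ) / d) / L) * w ≤ cut := by
  have hd0 : (0 : ℝ) < d := by exact_mod_cast (by omega : 0 < d)
  have hiso := isoConst_pos hd
  have hδ := profileConst_pos (α := α) hd hK hB
  have hmin : 0 ≤ min (L ^ (-ε₀)) (t ^ (-(1 : ℝ) / d) / L) := by positivity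
  rcases le_or_gt (w / 2) (B * S * M) with hc | hc
  · have hw2 : w ≤ 2 * B * (L ^ (η * d) * M) := by
      have : B * S * M ≤ B * L ^ (η * d) * M := by gcongr
      linarith
    calc profileConst d α K B * min (L ^ (-ε₀)) (t ^ (-(1 : ℝ) / d) / L) * w
        ≤ 1 / (2 * B) * L ^ (-ε₀) * (2 * B * (L ^ (η * d) * M)) := by
          gcongr
          · exact min_le_left _ _
          · exact min_le_left _ _
      _ = M * (L ^ (-ε₀) * L ^ (η * d)) := by field_simp
      _ = M * L ^ (-η) := by
          rw [← Real.rpow_add hL]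
          congr 2
          rw [← hη]
          ring
      _ ≤ M * r := by gcongr
      _ ≤ cut := h2
  · obtain ⟨y, hy⟩ : ∃ y, y = w / (2 * B) := ⟨_, rfl⟩
    have hy0 : 0 < y := by rw [hy]; positivity
    have hya : y ≤ a := by
      rw [hy, div_le_iff₀ (by positivity)]
      linarith
    have hyL : y ≤ t * ((B * K⁻¹ ^ d / (2 * B)) * L ^ d) := by
      rw [hy, div_le_iff₀ (by positivity)]
      refine hwt.trans (le_of_eq ?_)
      rw [div_pow, inv_pow]
      field_simp
    have hneg : t ^ (-(1 : ℝ) / d) * ((B * K⁻¹ ^ d / (2 * B)) ^ (-(1 : ℝ) / d) / L) ≤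
        y ^ (-(1 : ℝ) / d) := by
      have h := Real.rpow_le_rpow_of_nonpos hy0 hyL
        (show -(1 : ℝ) / d ≤ 0 from div_nonpos_of_nonpos_of_nonneg (by norm_num) hd0.le)
      rw [Real.mul_rpow ht.le (by positivity), Real.mul_rpow (by positivity) (by positivity),
        ← Real.rpow_natCast L d, ← Real.rpow_mul hL.le,
        show (d : ℝ) * (-(1 : ℝ) / d) = -1 by field_simp, Real.rpow_neg_one] at h
      exact h
    have hyd : y ^ (((d : ℝ) - 1) / d) = y * y ^ (-(1 : ℝ) / d) := by
      nth_rewrite 2 [← Real.rpow_one y]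
      rw [← Real.rpow_add hy0]
      congr 1
      field_simp
      ring
    have hexp := Real.exp_pos (-((d : ℝ) * (5 * K)) ^ α)
    have hlow : isoConst d * (y * (t ^ (-(1 : ℝ) / d) *
        ((B * K⁻¹ ^ d / (2 * B)) ^ (-(1 : ℝ) / d) / L))) *
        Real.exp (-(d * (5 * K)) ^ α) ≤ 2 * cut := by
      refine le_trans ?_ h3
      gcongr
      calc _ ≤ y * y ^ (-(1 : ℝ) / d) := by gcongr
        _ = y ^ (((d : ℝ) - 1) / d) := hyd.symm
        _ ≤ a ^ (((d : ℝ) - 1) / d) := by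
            have : (1 : ℝ) ≤ d := by exact_mod_cast (by omega : 1 ≤ d)
            exact Real.rpow_le_rpow hy0.le hya (div_nonneg (by linarith) hd0.le)
    calc profileConst d α K B * min (L ^ (-ε₀)) (t ^ (-(1 : ℝ) / d) / L) * w
        ≤ (isoConst d * Real.exp (-(d * (5 * K)) ^ α) / 2 *
            (1 / (2 * B) * (B * K⁻¹ ^ d / (2 * B)) ^ (-(1 : ℝ) / d))) *
            (t ^ (-(1 : ℝ) / d) / L) * w := by
          gcongr
          · exact min_le_right _ _
          · exact min_le_right _ _
      _ = (isoConst d * (y * (t ^ (-(1 : ℝ) / d) *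
            ((B * K⁻¹ ^ d / (2 * B)) ^ (-(1 : ℝ) / d) / L))) *
            Real.exp (-(d * (5 * K)) ^ α)) / 2 := by
          rw [hy]
          ring
      _ ≤ cut := by linarith

theorem eventually_mul_log_le_rpow (c : ℝ) {η : ℝ} (hη : 0 < η) :
    ∀ᶠ L : ℕ in atTop, c * Real.log L ≤ (L : ℝ) ^ η := by
  have hc : 0 < |c| + 1 := by positivity
  have h := (isLittleO_log_rpow_atTop hη).bound (inv_pos.2 hc)
  filter_upwards [tendsto_natCast_atTop_atTop.eventually h] with L hL
  rw [Real.norm_of_nonneg (Real.log_natCast_nonneg L), Real.norm_of_nonneg (by positivity)] at hL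
  have hlog := Real.log_natCast_nonneg L
  rw [inv_mul_eq_div, le_div_iff₀ hc] at hL
  have : c * Real.log L ≤ |c| * Real.log L := by
    gcongr
    exact le_abs_self c
  linarith

theorem eventually_mul_rpow_le {a b : ℝ} (hab : a < b) (c : ℝ) :
    ∀ᶠ x : ℝ in atTop, c * x ^ a ≤ x ^ b := by
  filter_upwards [(tendsto_rpow_atTop (sub_pos.2 hab)).eventually_ge_atTop c,
    eventually_gt_atTop 0] with x hx hx0
  calc c * x ^ a ≤ x ^ (b - a) * x ^ a := by gcongr
    _ = x ^ b := by rw [← Real.rpow_add hx0, sub_add_cancel]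

theorem tendsto_log_natCast_atTop : Tendsto (fun L : ℕ => Real.log L) atTop atTop :=
  Real.tendsto_log_atTop.comp tendsto_natCast_atTop_atTop

theorem eventually_blockSize_le (hd : 2 ≤ d) :
    ∀ᶠ L : ℕ in atTop, (blockSize d L : ℝ) + 5 ≤
      (((d : ℝ) + 2) ^ ((1 : ℝ) / d) + 7) * Real.log L ^ ((1 : ℝ) / d) := by
  filter_upwards [tendsto_log_natCast_atTop.eventually_ge_atTop 1] with L hL
  have h1 : (1 : ℝ) ≤ Real.log L ^ ((1 : ℝ) / d) := Real.one_le_rpow hL (by positivity)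
  have h2 := Nat.ceil_lt_add_one
    (show 0 ≤ ((d + 2 : ℝ) * Real.log L) ^ ((1 : ℝ) / d) from Real.rpow_nonneg (by positivity) _)
  rw [Real.mul_rpow (by positivity) (by linarith)] at h2
  unfold blockSize
  rw [Real.mul_rpow (by positivity) (by linarith)]
  push_cast
  nlinarith

/-- Comparison of the scales used in the construction. -/
theorem eventually_scales (hd : 2 ≤ d) {α : ℝ} (hα0 : 0 < α) (hαd : α < d) {K η : ℝ} (hK : 0 < K)
    (hη0 : 0 < η) (hη1 : η < 1) :
    ∀ᶠ L : ℕ in atTop, 1 ≤ L ∧ blockSize d L ≤ ⌊(L : ℝ) ^ η⌋₊ ∧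
      ⌊(L : ℝ) ^ η⌋₊ ≤ halfSide K L ∧ (L : ℝ) ^ η ≤ 2 * (⌊(L : ℝ) ^ η⌋₊ : ℝ) ∧
      (clusterSize d L : ℝ) ≤ isoConst d * (⌊(L : ℝ) ^ η⌋₊ : ℝ) ^ (d - 1) ∧
      (2 * (d * (K * (blockSize d L + 5)))) ^ α ≤ η * Real.log L := by
  have hd0 : (0 : ℝ) < d := by exact_mod_cast (by omega : 0 < d)
  have hd1 : (1 : ℝ) ≤ d := by exact_mod_cast (by omega : 1 ≤ d)
  have hiso := isoConst_pos hd
  obtain ⟨c, hc⟩ : ∃ c, c = ((d : ℝ) + 2) ^ ((1 : ℝ) / d) + 7 := ⟨_, rfl⟩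
  have hc0 : 0 < c := by rw [hc]; positivity
  have hαd' : 1 / (d : ℝ) * α < 1 := by
    rw [one_div_mul_eq_div, div_lt_one hd0]
    exact hαd
  have h1 := eventually_mul_log_le_rpow c hη0
  have h2 := tendsto_natCast_atTop_atTop.eventually (eventually_mul_rpow_le hη1 (2 * K))
  have h3 := eventually_mul_log_le_rpow (2 / isoConst d * (2 * d + 4)) hη0
  have h4 := tendsto_log_natCast_atTop.eventually
    (eventually_mul_rpow_le hαd' ((2 * (d * (K * c))) ^ α / η))
  have h5 := eventually_mul_log_le_rpow 2 hη0
  filter_upwards [h1, h2, h3, h4, h5, eventually_blockSize_le hd, eventually_ge_atTop 1,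
    tendsto_log_natCast_atTop.eventually_ge_atTop 1] with L h1 h2 h3 h4 h5 hb hL hlog
  rw [← hc] at hb
  rw [Real.rpow_one] at h2 h4
  have hfloor : (L : ℝ) ^ η ≤ 2 * (⌊(L : ℝ) ^ η⌋₊ : ℝ) := by
    have := Nat.lt_floor_add_one ((L : ℝ) ^ η)
    linarith
  have hs1 : 1 ≤ ⌊(L : ℝ) ^ η⌋₊ := Nat.le_floor (by push_cast; linarith)
  refine ⟨hL, Nat.le_floor ?_, Nat.floor_le_floor ?_, hfloor, ?_, ?_⟩
  · have : Real.log L ^ ((1 : ℝ) / d) ≤ Real.log L := by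
      refine Real.rpow_le_self_of_one_le hlog ?_
      rw [div_le_one hd0]
      exact hd1
    have : c * Real.log L ^ ((1 : ℝ) / d) ≤ c * Real.log L := by gcongr
    linarith
  · rw [le_div_iff₀ (by positivity)]
    linarith
  · have hk : (clusterSize d L : ℝ) ≤ (2 * d + 4) * Real.log L := by
      have := Nat.ceil_lt_add_one (show 0 ≤ (2 * d + 2 : ℝ) * Real.log L by positivity)
      unfold clusterSize
      push_cast
      nlinarith
    have hpow : (⌊(L : ℝ) ^ η⌋₊ : ℝ) ≤ (⌊(L : ℝ) ^ η⌋₊ : ℝ) ^ (d - 1) :=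
      le_self_pow₀ (by exact_mod_cast hs1) (by omega)
    have h6 : (2 * d + 4) * Real.log L ≤ isoConst d * ((L : ℝ) ^ η / 2) := by
      rw [div_mul_eq_mul_div, div_mul_eq_mul_div, div_le_iff₀ hiso] at h3
      linarith
    calc (clusterSize d L : ℝ) ≤ isoConst d * ((L : ℝ) ^ η / 2) := hk.trans h6
      _ ≤ isoConst d * (⌊(L : ℝ) ^ η⌋₊ : ℝ) ^ (d - 1) := by
          gcongr
          linarith
  · calc (2 * (d * (K * (blockSize d L + 5)))) ^ α
        ≤ (2 * (d * (K * (c * Real.log L ^ ((1 : ℝ) / d))))) ^ α := by gcongr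
      _ = (2 * (d * (K * c))) ^ α * Real.log L ^ (1 / (d : ℝ) * α) := by
          rw [Real.rpow_mul (by linarith), ← Real.mul_rpow (by positivity)
            (Real.rpow_nonneg (by linarith) _)]
          ring_nf
      _ ≤ η * Real.log L := by
          rw [div_mul_eq_mul_div, div_le_iff₀ hη0] at h4
          linarith

theorem mul_halfSide_le {K : ℝ} (hK : 0 < K) (L : ℕ) : K * halfSide K L ≤ (L : ℝ) / 2 := by
  have h := two_mul_halfSide_le hK L
  rw [le_div_iff₀ hK] at h
  push_cast at h
  linarith

theorem le_mul_halfSide_add_one {K : ℝ} (hK : 0 < K) (L : ℕ) :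
    (L : ℝ) / 2 ≤ K * (halfSide K L + 1) := by
  have h := (Nat.lt_floor_add_one ((L : ℝ) / (2 * K))).le
  rw [div_le_iff₀ (by positivity)] at h
  unfold halfSide
  linarith

theorem Wsum_add_Wsum_sdiff {α : ℝ} {E U : Finset (Pt d)} (hU : U ⊆ E) (i : ℕ) :
    Wsum α E i U + Wsum α E i (E \ U) = Wsum α E i E := by
  unfold Wsum
  rw [add_comm]
  exact Finset.sum_sdiff hU

theorem two_le_card_of_blocks (hd : 2 ≤ d) {E : Finset (Pt d)} {K : ℝ} {m b : ℕ}
    {G : (Fin d → ℕ) → Prop} (hbm : 2 * b ≤ 2 * m)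
    (hEG : ∀ x : Fin d → ℕ, (∀ i, x i < 2 * m) → G x → ∃ p ∈ E, siteOf K m p = x)
    (hblock : ∀ z : Fin d → ℕ, (∀ i, z i + b ≤ 2 * m) → ∃ y ∈ blockSites z b, G y) :
    2 ≤ E.card := by
  have hblock' : ∀ c : ℕ, c + b ≤ 2 * m → ∃ p ∈ E, ∀ i, c ≤ siteOf K m p i ∧
      siteOf K m p i < c + b := by
    intro c hc
    obtain ⟨y, hy, hGy⟩ := hblock (fun _ => c) fun _ => hc
    have hy' := mem_blockSites.1 hy
    obtain ⟨p, hp, rfl⟩ := hEG y (fun i => (hy' i).2.trans_le hc) hGy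
    exact ⟨p, hp, hy'⟩
  obtain ⟨p, hp, hp'⟩ := hblock' 0 (by omega)
  obtain ⟨q, hq, hq'⟩ := hblock' b (by omega)
  refine Finset.one_lt_card.2 ⟨p, hp, q, hq, ?_⟩
  rintro rfl
  have h1 := hp' ⟨0, by omega⟩
  have h2 := hq' ⟨0, by omega⟩
  omega

theorem le_isoProfile {α : ℝ} {E : Finset (Pt d)} (hE : 2 ≤ E.card) {i : ℕ} {t r : ℝ}
    (h : ∀ U ⊆ E, 0 < Wsum α E i U → Wsum α E i U ≤ t * Wsum α E i E →
      r * Wsum α E i U ≤ ∑ x ∈ U, ∑ y ∈ E \ U, rate α x y) :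
    ENNReal.ofReal r ≤ isoProfile α E i t := by
  refine le_iInf fun U => le_iInf fun hU => le_iInf fun hne => le_iInf fun hUt => ?_
  have hpos : 0 < Wsum α E i U := Finset.sum_pos (fun x hx => wgt_pos hE i (hU hx)) hne
  refine ENNReal.ofReal_le_ofReal ?_
  rw [conduct, le_div_iff₀ hpos]
  exact h U hU hpos hUt

theorem inv_le_min_rpow {L ε : ℝ} (hL : 1 ≤ L) (hε : ε ≤ 1) {t : ℝ} (ht0 : 0 < t) (ht1 : t ≤ 1)
    (d : ℕ) : L⁻¹ ≤ min (L ^ (-ε)) (t ^ (-(1 : ℝ) / d) / L) := by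
  refine le_min ?_ ?_
  · rw [← Real.rpow_neg_one]
    exact Real.rpow_le_rpow_of_exponent_le hL (by linarith)
  · rw [← one_div]
    gcongr
    exact Real.one_le_rpow_of_pos_of_le_one_of_nonpos ht0 ht1
      (div_nonpos_of_nonpos_of_nonneg (by norm_num) (Nat.cast_nonneg d))

/-- Isoperimetric lower bound for all configurations satisfying the typical properties. -/
theorem le_isoProfile_of_good (hd : 2 ≤ d) {α : ℝ} (hα : 0 < α) {ξ : Config d}
    {K η ε₀ C : ℝ} (hK : 0 < K) (hC : 0 < C) (hηε : η * (d + 1) = ε₀) {L : ℕ}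
    (hfin : (ξ ∩ cube d L).Finite)
    (hG : ∀ X : Finset (Fin d → ℕ), X ⊆ gridBox d (2 * halfSide K L) → NearConn X →
      clusterSize d L ≤ X.card → X.card ≤ 2 * (fullyGood (goodSite ξ K (halfSide K L)) X).card)
    (hblock : ∀ z : Fin d → ℕ, (∀ i, z i + blockSize d L ≤ 2 * halfSide K L) →
      ∃ y ∈ blockSites z (blockSize d L), goodSite ξ K (halfSide K L) y)
    (hR : ∀ x : Fin d → ℤ, (Vcube d L η x ∩ cube d L).Nonempty →
      Rfun α (Vcube d L η x) ξ ≤ ENNReal.ofReal (C * (L : ℝ) ^ (η * d)))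
    (hL : 1 ≤ L) (hbs : blockSize d L ≤ ⌊(L : ℝ) ^ η⌋₊) (hsm : ⌊(L : ℝ) ^ η⌋₊ ≤ halfSide K L)
    (hLs : (L : ℝ) ^ η ≤ 2 * (⌊(L : ℝ) ^ η⌋₊ : ℝ))
    (hks : (clusterSize d L : ℝ) ≤ isoConst d * (⌊(L : ℝ) ^ η⌋₊ : ℝ) ^ (d - 1))
    (hlog : (2 * (d * (K * (blockSize d L + 5)))) ^ α ≤ η * Real.log L) (i : ℕ) :
    2 ≤ hfin.toFinset.card ∧ ∀ t : ℝ, 0 < t → t ≤ 1 / 2 →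
      ENNReal.ofReal (profileConst d α K (cellConst d K C) *
        min ((L : ℝ) ^ (-ε₀)) (t ^ (-(1 : ℝ) / d) / L)) ≤ isoProfile α hfin.toFinset i t := by
  have hB := cellConst_pos (d := d) (K := K) hC
  have hb : 1 ≤ blockSize d L := Nat.le_add_left 1 _
  obtain ⟨s, hs⟩ : ∃ s, s = ⌊(L : ℝ) ^ η⌋₊ := ⟨_, rfl⟩
  obtain ⟨m, hm⟩ : ∃ m, m = halfSide K L := ⟨_, rfl⟩
  obtain ⟨E, hE⟩ : ∃ E, E = hfin.toFinset := ⟨_, rfl⟩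
  have hmem : ∀ p, p ∈ E ↔ p ∈ ξ ∩ cube d L := fun p => by rw [hE, Set.Finite.mem_toFinset]
  have hKm := mul_halfSide_le hK L
  have hKm' := le_mul_halfSide_add_one hK L
  have hN := two_mul_halfSide_le hK L
  rw [← hs] at hbs hsm hLs hks
  rw [← hm] at hG hblock hsm hKm hKm' hN
  rw [← hE]
  have hL0 : (0 : ℝ) < L := by exact_mod_cast hL
  have hsL : (s : ℝ) ≤ (L : ℝ) ^ η := hs ▸ Nat.floor_le (by positivity)
  have hs1 : 1 ≤ s := hb.trans hbs
  have hm1 : 1 ≤ m := hs1.trans hsm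
  have hEm : ∀ p ∈ E, ∀ i, |p i| ≤ K * (m + 1) := fun p hp i =>
    (((hmem p).1 hp).2 i).trans hKm'
  have hEG : ∀ x : Fin d → ℕ, (∀ i, x i < 2 * m) → goodSite ξ K m x →
      ∃ p ∈ E, siteOf K m p = x := by
    rintro x hx ⟨p, hpξ, hp⟩
    exact ⟨p, (hmem p).2 ⟨hpξ, mem_cube_of_mem_Kcube hK hKm hx hp⟩,
      siteOf_eq_of_mem_Kcube hK hx hp⟩
  have hcard : 2 ≤ E.card := two_le_card_of_blocks hd (by omega) hEG hblock
  have hcell := sum_wgt_cell_le hα (fun p hp => ((hmem p).1 hp).1)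
    (fun p hp => ((hmem p).1 hp).2) hC hR hK hm1 hs1 hEm hsL hLs i
  refine ⟨hcard, fun t ht0 ht1 => le_isoProfile hcard fun U hU hpos hUt => ?_⟩
  obtain ⟨M, a, hM, -, h1, h2, h3⟩ := exists_cut_lower_bounds hd hα.le hU hK hm1 hb hbs
    (by omega) hEm hEG hG hblock hks (wgt_nonneg α E i) hB.le hcell
  have hadd := Wsum_add_Wsum_sdiff (α := α) hU i
  have hE0 : 0 ≤ Wsum α E i E := Finset.sum_nonneg fun x _ => wgt_nonneg α E i x
  have hle : Wsum α E i U ≤ Wsum α E i (E \ U) := by nlinarith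
  refine profile_mul_le_cut hd hK hB hL0 hηε hpos ht0 hM (S := (s : ℝ) ^ d) ?_
    ((min_eq_left hle).symm.trans_le h1) h2 ?_ h3 (hUt.trans ?_)
  · rw [Real.rpow_mul hL0.le, Real.rpow_natCast]
    gcongr
  · rw [Real.rpow_def_of_pos hL0]
    refine Real.exp_le_exp.2 ?_
    linarith
  · gcongr
    refine (Wsum_le hs1 (by omega) hB.le hcell).trans ?_
    gcongr

/-- Theorem 1.1: lower bound on the isoperimetric profile and Cheeger's constant. -/
theorem stmt_0 (hd : 2 ≤ d) (α : ℝ) (hα0 : 0 < α) (hαd : α < d)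
    (P : Measure (Config d)) (hP : IsPointProcess P)
    (hA1 : AssumptionA1 P) (hA2 : AssumptionA2 α P)
    (i : ℕ) (hi : i ∈ ({1, 2, 3} : Set ℕ)) (ε : ℝ) (hε : 0 < ε) :
    ∃ δ : ℝ, 0 < δ ∧
      ∀ᵐ ξ ∂P, ∀ᶠ L : ℕ in atTop,
        ∃ hfin : (ξ ∩ cube d L).Finite, 2 ≤ hfin.toFinset.card ∧
          (∀ t : ℝ, 0 < t → t ≤ 1 / 2 →
            ENNReal.ofReal (δ * min ((L : ℝ) ^ (-ε)) (t ^ (-(1 : ℝ) / d) / L)) ≤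
              isoProfile α hfin.toFinset i t) ∧
          ENNReal.ofReal (δ / L) ≤ cheeger α hfin.toFinset i := by
  have hd0 : (0 : ℝ) < d := by exact_mod_cast (by omega : 0 < d)
  obtain ⟨ε₀, hε₀⟩ : ∃ ε₀, ε₀ = min ε (1 / 2) := ⟨_, rfl⟩
  have hε₀pos : 0 < ε₀ := hε₀ ▸ lt_min hε (by norm_num)
  have hε₀le : ε₀ ≤ ε := hε₀ ▸ min_le_left _ _
  have hε₀half : ε₀ ≤ 1 / 2 := hε₀ ▸ min_le_right _ _
  have hη0 : 0 < ε₀ / (d + 1) := by positivity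
  have hη1 : ε₀ / (d + 1) < 1 := by
    rw [div_lt_one (by positivity)]
    linarith
  obtain ⟨K, hK, hgood⟩ := exists_scale_eventually_good hd hP hA1
  obtain ⟨C, hC, hR⟩ := hA2 _ hη0 hη1
  have hδ := profileConst_pos (α := α) hd hK (cellConst_pos (d := d) (K := K) hC)
  refine ⟨profileConst d α K (cellConst d K C), hδ, ?_⟩
  filter_upwards [hP.2, hgood, hR] with ξ hfinite hgood hR
  filter_upwards [hgood, hR, eventually_scales hd hα0 hαd hK hη0 hη1] with L hgood hR hscales
  obtain ⟨hL, hbs, hsm, hLs, hks, hlog⟩ := hscales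
  have hL1 : (1 : ℝ) ≤ L := by exact_mod_cast hL
  obtain ⟨hcard, hprofile⟩ := le_isoProfile_of_good hd hα0 hK hC
    (div_mul_cancel₀ ε₀ (by positivity)) (hfinite _ (isBounded_cube L)) hgood.1 hgood.2 hR
    hL hbs hsm hLs hks hlog i
  refine ⟨hfinite _ (isBounded_cube L), hcard, fun t ht0 ht1 => ?_, ?_⟩
  · refine le_trans (ENNReal.ofReal_le_ofReal ?_) (hprofile t ht0 ht1)
    gcongr
  · refine le_trans (ENNReal.ofReal_le_ofReal ?_) (hprofile (1 / 2) (by norm_num) le_rfl)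
    rw [div_eq_mul_inv]
    gcongr
    exact inv_le_min_rpow hL1 (by linarith) (by norm_num) (by norm_num) d

end
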